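/- arXiv:1204.3161 — 6 statements merged into one kernel-verified Lean document; each statement's English description precedes it below -/
import Mathlib

section
/- For each integer d ≥ 5, the integer d − 1 is a typical rank for real bivariate homogeneous forms of degree d. -/
/-!
We model the space `K[x,y]_d` of degree-`d` homogeneous bivariate forms over `K`
by its coefficient vectors `Fin (d+1) → K`, where `f i` is the coefficient of
`x^i * y^(d-i)`.  A linear form `p*x + q*y ∈ K[x,y]_1` is modeled by the pair
`(p, q) : K × K`; `powVec d (p,q)` is the coefficient vector of `(p*x + q*y)^d`.
-/

/-- Coefficient vector of `(p*x + q*y)^d` in the basis `x^i y^(d-i)`. -/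
noncomputable def powVec {K : Type*} [CommRing K] (d : ℕ) (L : K × K) :
    Fin (d + 1) → K :=
  fun i => (d.choose (i : ℕ) : K) * L.1 ^ (i : ℕ) * L.2 ^ (d - (i : ℕ))

/-- The rank over `K` of a degree-`d` form: the minimal `r` such that
`f = ∑_{i=1}^r c_i L_i^d` with `c_i ∈ K` and linear forms `L_i ∈ K[x,y]_1`. -/
noncomputable def rankK (K : Type*) [CommRing K] (d : ℕ) (f : Fin (d + 1) → K) : ℕ :=
  sInf {r : ℕ | ∃ (c : Fin r → K) (L : Fin r → K × K), f = ∑ i, c i • powVec d (L i)}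

/-- The real rank `Rsr` of a real binary form of degree `d`. -/
noncomputable def Rsr (d : ℕ) (f : Fin (d + 1) → ℝ) : ℕ := rankK ℝ d f

/-- The complex rank `Csr` of a complex binary form of degree `d`. -/
noncomputable def Csr (d : ℕ) (f : Fin (d + 1) → ℂ) : ℕ := rankK ℂ d f

/-- A real form regarded as a complex form (coefficientwise inclusion `ℝ ↪ ℂ`). -/
noncomputable def complexify {d : ℕ} (f : Fin (d + 1) → ℝ) : Fin (d + 1) → ℂ :=
  fun i => (f i : ℂ)

/-- `t` is a typical rank in degree `d`: there is a nonempty euclidean-open set of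
real degree-`d` forms on which the real rank is constantly `t`. -/
def IsTypicalRank (d t : ℕ) : Prop :=
  ∃ V : Set (Fin (d + 1) → ℝ), IsOpen V ∧ V.Nonempty ∧ ∀ f ∈ V, Rsr d f = t

/-- Two linear forms (modeled as coefficient pairs) are proportional if one is a
scalar multiple of the other. -/
def AreProportional {K : Type*} [CommRing K] (u v : K × K) : Prop :=
  ∃ t : K, v = t • u ∨ u = t • v

open Filter Topology

/-- The set of forms of degree `d` that are sums of `r` scaled `d`-th powers. -/
def powerSums (d r : ℕ) : Set (Fin (d + 1) → ℝ) :=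
  {f | ∃ (c : Fin r → ℝ) (L : Fin r → ℝ × ℝ), f = ∑ i, c i • powVec d (L i)}

/-- Sums of `r` scaled `d`-th powers with nonzero scalars and pairwise distinct linear forms
`t i * x + y`. -/
def genericPowerSums (d r : ℕ) : Set (Fin (d + 1) → ℝ) :=
  {f | ∃ c t : Fin r → ℝ, (∀ i, c i ≠ 0) ∧ Function.Injective t ∧
    f = ∑ i, c i • powVec d (t i, 1)}

theorem zero_mem_powerSums (d r : ℕ) : (0 : Fin (d + 1) → ℝ) ∈ powerSums d r :=
  ⟨0, 0, by simp⟩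

theorem add_smul_powVec_mem_powerSums {d r : ℕ} {f : Fin (d + 1) → ℝ} (hf : f ∈ powerSums d r)
    (c : ℝ) (L : ℝ × ℝ) : f + c • powVec d L ∈ powerSums d (r + 1) := by
  obtain ⟨c', L', rfl⟩ := hf
  exact ⟨Fin.snoc c' c, Fin.snoc L' L, by simp [Fin.sum_univ_castSucc]⟩

theorem powerSums_mono (d : ℕ) : Monotone (powerSums d) :=
  monotone_nat_of_le_succ fun r f hf => by
    simpa using add_smul_powVec_mem_powerSums hf 0 0

theorem sum_powVec_mul_pow {d : ℕ} (t s : ℝ) :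
    ∑ j : Fin (d + 1), powVec d (t, 1) j * s ^ (j : ℕ) = (1 + t * s) ^ d := by
  rw [add_comm (1 : ℝ), add_pow, Finset.sum_range]
  refine Finset.sum_congr rfl fun j _ => ?_
  simp only [powVec, one_pow, mul_one, mul_pow]
  ring

/-- A subspace of `Fin n → ℝ` with trivial orthogonal complement is everything. -/
theorem eq_top_of_forall_dotProduct_eq_zero {n : ℕ} (M : Submodule ℝ (Fin n → ℝ))
    (h : ∀ w : Fin n → ℝ, (∀ v ∈ M, ∑ i, v i * w i = 0) → w = 0) : M = ⊤ := by
  by_contra hM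
  obtain ⟨φ, hφ, hle⟩ := M.exists_le_ker_of_lt_top (lt_top_iff_ne_top.2 hM)
  have key : ∀ v, φ v = ∑ i, v i * φ (Pi.single i 1) := fun v => by
    conv_lhs => rw [pi_eq_sum_univ' v]
    simp
  have hw := h (fun i => φ (Pi.single i 1)) fun v hv => by
    rw [← key]
    exact hle hv
  apply hφ
  ext i
  simpa using congrFun hw i

/-- The polynomial whose value at `t` is the pairing of `w` with the power `(t * x + y) ^ d`. -/
noncomputable def pairingPoly {d : ℕ} (w : Fin (d + 1) → ℝ) : Polynomial ℝ :=
  ∑ j : Fin (d + 1), Polynomial.C ((d.choose j : ℝ) * w j) * Polynomial.X ^ (j : ℕ)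

theorem eval_pairingPoly {d : ℕ} (w : Fin (d + 1) → ℝ) (t : ℝ) :
    (pairingPoly w).eval t = ∑ j, powVec d (t, 1) j * w j := by
  simp only [pairingPoly, Polynomial.eval_finsetSum, powVec]
  refine Finset.sum_congr rfl fun j _ => ?_
  simp
  ring

theorem natDegree_pairingPoly_le {d : ℕ} (w : Fin (d + 1) → ℝ) :
    (pairingPoly w).natDegree ≤ d :=
  Polynomial.natDegree_sum_le_of_forall_le _ _ fun j _ =>
    (Polynomial.natDegree_C_mul_X_pow_le _ _).trans (Nat.lt_succ_iff.1 j.2)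

theorem eq_zero_of_pairingPoly_eq_zero {d : ℕ} {w : Fin (d + 1) → ℝ}
    (h : pairingPoly w = 0) : w = 0 := by
  ext j
  have hj : (pairingPoly w).coeff j = 0 := by simp [h]
  have hc : (d.choose j : ℝ) ≠ 0 := by
    exact_mod_cast (Nat.choose_pos (Nat.lt_succ_iff.1 j.2)).ne'
  simpa [pairingPoly, Polynomial.finsetSum_coeff, Polynomial.coeff_C_mul, Polynomial.coeff_X_pow,
    Fin.val_inj, hc, -map_mul] using hj

theorem span_powVec_eq_top (d : ℕ) :
    Submodule.span ℝ (Set.range fun t : ℝ => powVec d (t, (1 : ℝ))) = ⊤ := by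
  refine eq_top_of_forall_dotProduct_eq_zero _ fun w hw => eq_zero_of_pairingPoly_eq_zero ?_
  refine Polynomial.funext fun t => ?_
  rw [eval_pairingPoly, hw _ (Submodule.subset_span ⟨t, rfl⟩), Polynomial.eval_zero]

/-- A polynomial of degree less than `2 * r` with `r` distinct double roots is zero. -/
theorem Polynomial.eq_zero_of_double_roots {r : ℕ} {P : Polynomial ℝ} {t : Fin r → ℝ}
    (ht : Function.Injective t) (hdeg : P.natDegree < 2 * r) (h0 : ∀ i, P.eval (t i) = 0)
    (h1 : ∀ i, P.derivative.eval (t i) = 0) : P = 0 := by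
  by_contra hP
  have hdvd : ∏ i, (Polynomial.X - Polynomial.C (t i)) ^ 2 ∣ P := by
    refine Finset.prod_dvd_of_coprime (fun i _ j _ hij => ?_) fun i _ => ?_
    · exact (Polynomial.isCoprime_X_sub_C_of_isUnit_sub
        (sub_ne_zero.2 (ht.ne hij)).isUnit).pow
    · rw [← Polynomial.le_rootMultiplicity_iff hP]
      exact (Polynomial.one_lt_rootMultiplicity_iff_isRoot hP).2 ⟨h0 i, h1 i⟩
  have hle := Polynomial.natDegree_le_of_dvd hdvd hP
  rw [Polynomial.natDegree_prod _ _ fun i _ =>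
    pow_ne_zero _ (Polynomial.X_sub_C_ne_zero _)] at hle
  simp at hle
  omega

/-- A generic sum of sufficiently many powers is an interior point of the set of power sums. -/
theorem powerSums_mem_𝓝 {d r : ℕ} (hr : d < 2 * r) {f : Fin (d + 1) → ℝ}
    (hf : f ∈ genericPowerSums d r) : powerSums d r ∈ 𝓝 f := by
  obtain ⟨c, t, hc, ht, rfl⟩ := hf
  set Φ : (Fin r → ℝ) × (Fin r → ℝ) → Fin (d + 1) → ℝ :=
    fun x => ∑ i, x.1 i • powVec d (x.2 i, 1) with hΦ
  have hsm : ContDiff ℝ 1 Φ := by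
    rw [contDiff_pi]
    intro j
    simp only [hΦ, powVec, Finset.sum_apply, Pi.smul_apply, smul_eq_mul]
    fun_prop
  have hstrict := hsm.contDiffAt.hasStrictFDerivAt (x := (c, t)) one_ne_zero
  have hsurj : (fderiv ℝ Φ (c, t)).range = ⊤ := by
    refine eq_top_of_forall_dotProduct_eq_zero
      (fderiv ℝ Φ (c, t) : (Fin r → ℝ) × (Fin r → ℝ) →ₗ[ℝ] Fin (d + 1) → ℝ).range
      fun w hw => eq_zero_of_pairingPoly_eq_zero ?_
    set P := pairingPoly w with hP
    have hψ : ∀ x, ∑ j, Φ x j * w j = ∑ i, x.1 i * P.eval (x.2 i) := fun x => by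
      simp only [hP, eval_pairingPoly, hΦ, Finset.sum_apply, Pi.smul_apply, smul_eq_mul,
        Finset.sum_mul, Finset.mul_sum]
      rw [Finset.sum_comm]
      simp only [mul_assoc]
    have hd1 : HasFDerivAt (fun x => ∑ j, Φ x j * w j)
        (0 : (Fin r → ℝ) × (Fin r → ℝ) →L[ℝ] ℝ) (c, t) := by
      have := HasFDerivAt.fun_sum (u := Finset.univ) fun j _ =>
        ((hasFDerivAt_pi'.1 hstrict.hasFDerivAt j).mul_const (w j))
      refine this.congr_fderiv (ContinuousLinearMap.ext fun v => ?_)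
      have hv := hw (fderiv ℝ Φ (c, t) v) (LinearMap.mem_range.2 ⟨v, rfl⟩)
      simpa [mul_comm] using hv
    have hd2 : HasFDerivAt (fun x : (Fin r → ℝ) × (Fin r → ℝ) => ∑ i, x.1 i * P.eval (x.2 i))
        (∑ i, (c i • P.derivative.eval (t i) •
          ((ContinuousLinearMap.proj i).comp (ContinuousLinearMap.snd ℝ (Fin r → ℝ) (Fin r → ℝ))) +
          P.eval (t i) •
          ((ContinuousLinearMap.proj i).comp (ContinuousLinearMap.fst ℝ (Fin r → ℝ) (Fin r → ℝ)))))
        (c, t) := by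
      refine HasFDerivAt.fun_sum fun i _ => ?_
      have e1 : HasFDerivAt (fun x : (Fin r → ℝ) × (Fin r → ℝ) => x.1 i) _ (c, t) :=
        ((ContinuousLinearMap.proj i).comp
          (ContinuousLinearMap.fst ℝ (Fin r → ℝ) (Fin r → ℝ))).hasFDerivAt
      have e2 : HasFDerivAt (fun x : (Fin r → ℝ) × (Fin r → ℝ) => x.2 i) _ (c, t) :=
        ((ContinuousLinearMap.proj i).comp
          (ContinuousLinearMap.snd ℝ (Fin r → ℝ) (Fin r → ℝ))).hasFDerivAt
      exact e1.mul (HasDerivAt.comp_hasFDerivAt (c, t) (h₂ := fun s => P.eval s)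
        (P.hasDerivAt (t i)) e2)
    simp only [hψ] at hd1
    have huniq := hd1.unique hd2
    refine Polynomial.eq_zero_of_double_roots ht
      ((natDegree_pairingPoly_le w).trans_lt hr) (fun i => ?_) fun i => ?_
    · simpa [Pi.single_apply] using
        (congrArg (fun A => A (Pi.single i 1, 0)) huniq).symm
    · simpa [Pi.single_apply, hc] using
        (congrArg (fun A => A (0, Pi.single i 1)) huniq).symm
  have hmap := hstrict.map_nhds_eq_of_surj hsurj
  change powerSums d r ∈ 𝓝 (Φ (c, t))
  rw [← hmap]
  exact mem_map.2 (Eventually.of_forall fun x => ⟨x.1, fun i => (x.2 i, 1), rfl⟩)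

theorem powVec_eq_smul {d : ℕ} {p q : ℝ} (hq : q ≠ 0) :
    powVec d (p, q) = q ^ d • powVec d (p / q, 1) := by
  ext j
  have hj : q ^ d = q ^ (j : ℕ) * q ^ (d - (j : ℕ)) := by
    rw [← pow_add, Nat.add_sub_cancel' (Nat.lt_succ_iff.1 j.2)]
  simp only [powVec, Pi.smul_apply, smul_eq_mul, one_pow, mul_one, hj, div_pow]
  field_simp

theorem powerSums_subset_closure_genericPowerSums (d r : ℕ) :
    powerSums d r ⊆ closure (genericPowerSums d r) := by
  rintro _ ⟨c, L, rfl⟩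
  set F : ℝ → Fin (d + 1) → ℝ := fun ε =>
    ∑ i, (c i + ε) • powVec d ((L i).1 + (i : ℕ) * ε, (L i).2 + ε) with hF
  have hcont : Continuous F := by
    refine continuous_pi fun j => ?_
    simp only [hF, powVec, Finset.sum_apply, Pi.smul_apply, smul_eq_mul]
    fun_prop
  have hev : ∀ P : Polynomial ℝ, P ≠ 0 → ∀ᶠ ε in 𝓝[≠] (0 : ℝ), P.eval ε ≠ 0 := fun P hP => by
    have hfin : {ε | P.eval ε = 0}.Finite := by
      simpa [Polynomial.IsRoot] using Polynomial.finite_setOfPred_isRoot hP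
    exact hfin.eventually_cofinite_notMem.filter_mono (nhdsNE_le_cofinite 0)
  have hlin : ∀ a : ℝ, ∀ᶠ ε in 𝓝[≠] (0 : ℝ), a + ε ≠ 0 := fun a => by
    simpa [add_comm] using hev _ (Polynomial.X_add_C_ne_zero a)
  have hdist : ∀ i j : Fin r, i ≠ j → ∀ᶠ ε in 𝓝[≠] (0 : ℝ),
      ((L i).1 + (i : ℕ) * ε) * ((L j).2 + ε) ≠ ((L j).1 + (j : ℕ) * ε) * ((L i).2 + ε) := by
    intro i j hij
    have hij' : ((i : ℕ) : ℝ) - (j : ℕ) ≠ 0 := by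
      rw [sub_ne_zero]
      exact_mod_cast fun h => hij (Fin.ext h)
    let P : Polynomial ℝ := Polynomial.C ((i : ℕ) - (j : ℕ) : ℝ) * Polynomial.X ^ 2 +
      Polynomial.C ((i : ℕ) * (L j).2 + (L i).1 - (j : ℕ) * (L i).2 - (L j).1) * Polynomial.X +
      Polynomial.C ((L i).1 * (L j).2 - (L j).1 * (L i).2)
    have hP : P ≠ 0 := fun h => hij' <| by
      simpa [P, Polynomial.coeff_X, Polynomial.coeff_C, -map_sub, -map_add, -map_mul] using
        congrArg (fun Q : Polynomial ℝ => Q.coeff 2) h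
    filter_upwards [hev P hP] with ε hε h
    apply hε
    simp only [P, Polynomial.eval_add, Polynomial.eval_mul, Polynomial.eval_C,
      Polynomial.eval_pow, Polynomial.eval_X]
    linear_combination h
  have hgen : ∀ᶠ ε in 𝓝[≠] (0 : ℝ), F ε ∈ genericPowerSums d r := by
    have h1 : ∀ᶠ ε in 𝓝[≠] (0 : ℝ), ∀ i, c i + ε ≠ 0 :=
      eventually_all.2 fun i => hlin _
    have h2 : ∀ᶠ ε in 𝓝[≠] (0 : ℝ), ∀ i, (L i).2 + ε ≠ 0 :=
      eventually_all.2 fun i => hlin _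
    have h3 := eventually_all.2 fun i => eventually_all.2 fun j =>
      eventually_all.2 fun hij : i ≠ j => hdist i j hij
    filter_upwards [h1, h2, h3] with ε h1 h2 h3
    refine ⟨fun i => (c i + ε) * ((L i).2 + ε) ^ d,
      fun i => ((L i).1 + (i : ℕ) * ε) / ((L i).2 + ε),
      fun i => mul_ne_zero (h1 i) (pow_ne_zero _ (h2 i)), fun i j h => ?_, ?_⟩
    · by_contra hij
      exact h3 i j hij ((div_eq_div_iff (h2 i) (h2 j)).1 h)
    · simp only [hF, powVec_eq_smul (h2 _), mul_smul]
  have hlim : Tendsto F (𝓝[≠] 0) (𝓝 (F 0)) := hcont.continuousAt.mono_left nhdsWithin_le_nhds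
  simpa [hF] using mem_closure_of_tendsto hlim hgen

/-- A sum of `n + 1 ≤ d` scaled `d`-th powers of pairwise nonproportional linear forms has at most
`n + 1` pairwise nonproportional real zeros. -/
theorem card_zeros_le (n : ℕ) : ∀ (d : ℕ) (c t : Fin (n + 1) → ℝ) (Z : Finset (ℝ × ℝ)),
    n + 1 ≤ d → (∀ i, c i ≠ 0) → Function.Injective t →
    (∀ z ∈ Z, ∑ i, c i * (z.1 + t i * z.2) ^ d = 0) →
    (∀ z ∈ Z, ∀ z' ∈ Z, z ≠ z' → z.1 * z'.2 ≠ z'.1 * z.2) → Z.card ≤ n + 1 := by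
  induction n with
  | zero =>
    intro d c t Z hd hc _ hZ hcross
    refine Finset.card_le_one.2 fun z hz z' hz' => ?_
    by_contra hne
    have key : ∀ z ∈ Z, z.1 + t 0 * z.2 = 0 := fun z hz => by
      have h := hZ z hz
      rw [Fin.sum_univ_one, mul_eq_zero, or_iff_right (hc 0)] at h
      exact pow_eq_zero_iff (by omega) |>.1 h
    exact hcross z hz z' hz' hne (by linear_combination z'.2 * key z hz - z.2 * key z' hz')
  | succ n ih =>
    intro d c t Z hd hc ht hZ hcross
    obtain ⟨d, rfl⟩ : ∃ e, d = e + 1 := ⟨d - 1, by omega⟩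
    by_contra! hcard
    set τ := t (Fin.last (n + 1)) with hτ
    set c' : Fin (n + 1) → ℝ := fun i => c i.castSucc * (t i.castSucc - τ) with hc'
    set t' : Fin (n + 1) → ℝ := fun i => t i.castSucc with ht'
    have hne : ∀ i : Fin (n + 1), t i.castSucc - τ ≠ 0 := fun i =>
      sub_ne_zero.2 (ht.ne (Fin.castSucc_lt_last i).ne)
    have ih' := fun Z' => ih d c' t' Z' (by omega) (fun i => mul_ne_zero (hc _) (hne i))
      (ht.comp (Fin.castSucc_injective _))
    -- The restriction of the form to the affine line on which the last linear form equals `1`.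
    set h : Polynomial ℝ := ∑ i, Polynomial.C (c i) *
      (1 + Polynomial.C (t i - τ) * Polynomial.X) ^ (d + 1) with hh
    have hder : ∀ s, h.derivative.eval s =
        (d + 1) * ∑ i, c' i * ((1 - τ * s) + t' i * s) ^ d := fun s => by
      simp only [hh, Polynomial.derivative_sum, Polynomial.eval_finsetSum, Finset.mul_sum, hc', ht']
      rw [Fin.sum_univ_castSucc]
      simp [Polynomial.derivative_pow, ← hτ]
      refine Finset.sum_congr rfl fun i _ => ?_
      ring
    have hcross' : ∀ s s' : ℝ, s ≠ s' → (1 - τ * s) * s' ≠ (1 - τ * s') * s := fun s s' hs e =>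
      hs (by linear_combination -e)
    have hinj : Function.Injective fun s : ℝ => (1 - τ * s, s) := fun s s' e =>
      congrArg Prod.snd e
    have hd0 : (d + 1 : ℝ) ≠ 0 := by positivity
    have hzero : ∀ s, h.derivative.eval s = 0 →
        ∑ i, c' i * ((1 - τ * s) + t' i * s) ^ d = 0 := fun s hs => by
      rw [hder] at hs
      exact (mul_eq_zero.1 hs).resolve_left hd0
    have himg : ∀ S : Finset ℝ, (∀ s ∈ S, h.derivative.eval s = 0) → S.card ≤ n + 1 := by
      intro S hS
      rw [← Finset.card_image_of_injective S hinj]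
      refine ih' _ (fun z hz => ?_) fun z hz z' hz' hzz => ?_
      · obtain ⟨s, hs, rfl⟩ := Finset.mem_image.1 hz
        exact hzero s (hS s hs)
      · obtain ⟨s, hs, rfl⟩ := Finset.mem_image.1 hz
        obtain ⟨s', hs', rfl⟩ := Finset.mem_image.1 hz'
        exact hcross' s s' fun e => hzz (by rw [e])
    have hder0 : h.derivative ≠ 0 := fun h0 => by
      have := himg ((Finset.range (n + 2)).image fun k : ℕ => (k : ℝ)) (by simp [h0])
      rw [Finset.card_image_of_injective _ Nat.cast_injective, Finset.card_range] at this
      omega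
    have hh0 : h ≠ 0 := fun h0 => hder0 (by simp [h0])
    set S := h.derivative.roots.toFinset with hS
    have hSroot : ∀ s ∈ S, h.derivative.eval s = 0 := fun s hs => by
      simpa [hS, hder0] using hs
    set Z₁ := Z.filter fun z => z.1 + τ * z.2 ≠ 0 with hZ₁
    have hZ₁card : Z₁.card ≤ S.card + 1 := by
      refine le_trans ?_ (Polynomial.card_roots_toFinset_le_derivative h)
      refine Finset.card_le_card_of_injOn (fun z => z.2 / (z.1 + τ * z.2)) (fun z hz => ?_)
        fun z hz z' hz' e => ?_
      · obtain ⟨hzZ, hz0⟩ := Finset.mem_filter.1 (Finset.mem_coe.1 hz)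
        have : h.eval (z.2 / (z.1 + τ * z.2)) = 0 := by
          have e : ∀ i, c i * (1 + (t i - τ) * (z.2 / (z.1 + τ * z.2))) ^ (d + 1) =
              c i * (z.1 + t i * z.2) ^ (d + 1) * ((z.1 + τ * z.2)⁻¹) ^ (d + 1) := fun i => by
            rw [mul_assoc, ← mul_pow]
            congr 2
            field_simp
            ring
          simp only [hh, Polynomial.eval_finsetSum, Polynomial.eval_mul, Polynomial.eval_C,
            Polynomial.eval_pow, Polynomial.eval_add, Polynomial.eval_one, Polynomial.eval_X, e]
          rw [← Finset.sum_mul, hZ z hzZ, zero_mul]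
        simpa [hh0] using this
      · obtain ⟨hzZ, hz0⟩ := Finset.mem_filter.1 (Finset.mem_coe.1 hz)
        obtain ⟨hzZ', hz0'⟩ := Finset.mem_filter.1 (Finset.mem_coe.1 hz')
        by_contra hzz
        rw [div_eq_div_iff hz0 hz0'] at e
        exact hcross z hzZ z' hzZ' hzz (by linear_combination -e)
    by_cases hker : ∃ z ∈ Z, z.1 + τ * z.2 = 0
    · obtain ⟨z₀, hz₀, hk⟩ := hker
      have hZ₁' : Z₁ = Z.erase z₀ := by
        ext z
        simp only [hZ₁, Finset.mem_filter, Finset.mem_erase]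
        refine ⟨fun ⟨hz, h0⟩ => ⟨fun e => h0 (e ▸ hk), hz⟩, fun ⟨hzz, hz⟩ => ⟨hz, fun h0 => ?_⟩⟩
        exact hcross z hz z₀ hz₀ hzz (by linear_combination z₀.2 * h0 - z.2 * hk)
      rw [hZ₁', Finset.card_erase_of_mem hz₀] at hZ₁card
      have hy : z₀.2 ≠ 0 := fun h0 => by
        obtain ⟨z, hz, hzz⟩ := Finset.exists_mem_ne (by omega : 1 < Z.card) z₀
        have hx : z₀.1 = 0 := by simpa [h0] using hk
        exact hcross z hz z₀ hz₀ hzz (by simp [h0, hx])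
      have hnot : z₀ ∉ S.image fun s : ℝ => (1 - τ * s, s) := fun hmem => by
        obtain ⟨s, -, rfl⟩ := Finset.mem_image.1 hmem
        simp at hk
      have hz₀zero : ∑ i, c' i * (z₀.1 + t' i * z₀.2) ^ d = 0 := by
        have h0 := hZ z₀ hz₀
        have e : ∀ i, z₀.1 + t i * z₀.2 = (t i - τ) * z₀.2 := fun i => by
          linear_combination hk
        rw [Fin.sum_univ_castSucc (n := n + 1)] at h0
        rw [← hτ, hk, zero_pow d.succ_ne_zero, mul_zero, add_zero] at h0
        refine (mul_eq_zero.1 (?_ : z₀.2 * ∑ i, c' i * (z₀.1 + t' i * z₀.2) ^ d = 0)).resolve_left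
          hy
        rw [← h0, Finset.mul_sum]
        refine Finset.sum_congr rfl fun i _ => ?_
        simp only [hc', ht', e]
        ring
      have hfin := ih' (insert z₀ (S.image fun s : ℝ => (1 - τ * s, s))) ?_ ?_
      · rw [Finset.card_insert_of_notMem hnot, Finset.card_image_of_injective S hinj] at hfin
        omega
      · intro z hz
        rcases Finset.mem_insert.1 hz with rfl | hz
        · exact hz₀zero
        · obtain ⟨s, hs, rfl⟩ := Finset.mem_image.1 hz
          exact hzero s (hSroot s hs)
      · intro z hz z' hz' hzz
        rcases Finset.mem_insert.1 hz with hz | hz <;>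
        rcases Finset.mem_insert.1 hz' with hz' | hz'
        · exact absurd (hz.trans hz'.symm) hzz
        · obtain ⟨s, hs, rfl⟩ := Finset.mem_image.1 hz'
          subst hz
          exact fun e => hy (by linear_combination s * hk - e)
        · obtain ⟨s, hs, rfl⟩ := Finset.mem_image.1 hz
          subst hz'
          exact fun e => hy (by linear_combination s * hk + e)
        · obtain ⟨s, hs, rfl⟩ := Finset.mem_image.1 hz
          obtain ⟨s', hs', rfl⟩ := Finset.mem_image.1 hz'
          exact hcross' s s' fun e => hzz (by rw [e])
    · push Not at hker
      rw [hZ₁, Finset.filter_true_of_mem hker] at hZ₁card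
      have := himg S hSroot
      omega

/-- There is a nonempty open set of degree-`d` forms none of which is a generic sum of `d - 1`
powers: the forms with `d` prescribed sign changes. -/
theorem exists_isOpen_disjoint_genericPowerSums {n d : ℕ} (hd : d = n + 2) :
    ∃ U : Set (Fin (d + 1) → ℝ), IsOpen U ∧ U.Nonempty ∧
      Disjoint U (genericPowerSums d (n + 1)) := by
  set E : (Fin (d + 1) → ℝ) → ℝ → ℝ := fun a s => ∑ j, a j * s ^ (j : ℕ) with hE
  refine ⟨{a | ∀ k : Fin d, E a (k : ℕ) * E a ((k : ℕ) + 1) < 0}, ?_, ?_, ?_⟩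
  · rw [Set.ofPred_forall]
    refine isOpen_iInter_of_finite fun k => isOpen_lt ?_ continuous_const
    simp only [hE]
    fun_prop
  · set p : Polynomial ℝ := ∏ k ∈ Finset.range d, (Polynomial.X - Polynomial.C ((k : ℝ) + 1 / 2))
      with hp
    have hpd : p.natDegree = d := by
      rw [hp, Polynomial.natDegree_prod_of_monic _ _ fun k _ => Polynomial.monic_X_sub_C _]
      simp only [Polynomial.natDegree_X_sub_C, Finset.sum_const, Finset.card_range, smul_eq_mul,
        mul_one]
    have hEp : ∀ s, E (fun j => p.coeff j) s = p.eval s := fun s => by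
      rw [Polynomial.eval_eq_sum_range, hpd, Finset.sum_range]
    refine ⟨fun j => p.coeff j, fun k => ?_⟩
    rw [hEp, hEp, hp, Polynomial.eval_prod, Polynomial.eval_prod, ← Finset.prod_mul_distrib,
      ← Finset.mul_prod_erase _ _ (Finset.mem_range.2 k.2)]
    refine mul_neg_of_neg_of_pos (by simp; norm_num) (Finset.prod_pos fun l hl => ?_)
    simp only [Polynomial.eval_sub, Polynomial.eval_X, Polynomial.eval_C]
    rcases lt_or_gt_of_ne (Finset.mem_erase.1 hl).1 with h | h
    · have h' : (l : ℝ) + 1 ≤ (k : ℕ) := by exact_mod_cast h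
      exact mul_pos (by linarith) (by linarith)
    · have h' : ((k : ℕ) : ℝ) + 1 ≤ l := by exact_mod_cast h
      exact mul_pos_of_neg_of_neg (by linarith) (by linarith)
  · rw [Set.disjoint_left]
    rintro a ha ⟨c, t, hc, ht, rfl⟩
    set a := ∑ i, c i • powVec d (t i, 1) with ha'
    have hEa : ∀ s, E a s = ∑ i, c i * (1 + t i * s) ^ d := fun s => by
      simp only [hE, ha', ← sum_powVec_mul_pow, Finset.sum_apply, Pi.smul_apply, smul_eq_mul,
        Finset.sum_mul, Finset.mul_sum]
      rw [Finset.sum_comm]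
      simp only [mul_assoc]
    have hroot : ∀ k : Fin d, ∃ s ∈ Set.Ioo ((k : ℕ) : ℝ) ((k : ℕ) + 1), E a s = 0 := by
      intro k
      have hcont : ContinuousOn (E a) (Set.Icc ((k : ℕ) : ℝ) ((k : ℕ) + 1)) := by
        simp only [hE]
        fun_prop
      have hle : ((k : ℕ) : ℝ) ≤ (k : ℕ) + 1 := by linarith
      rcases mul_neg_iff.1 (ha k) with ⟨h1, h2⟩ | ⟨h1, h2⟩
      · exact intermediate_value_Ioo' hle hcont ⟨h2, h1⟩
      · exact intermediate_value_Ioo hle hcont ⟨h1, h2⟩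
    choose s hs hs0 using hroot
    have hsinj : Function.Injective s := fun k l e => by
      have h1 := hs k
      have h2 := hs l
      rw [e] at h1
      have h3 : ((k : ℕ) : ℝ) < (l : ℕ) + 1 := h1.1.trans h2.2
      have h4 : ((l : ℕ) : ℝ) < (k : ℕ) + 1 := h2.1.trans h1.2
      have h5 : (k : ℕ) < l + 1 := by exact_mod_cast h3
      have h6 : (l : ℕ) < k + 1 := by exact_mod_cast h4
      exact Fin.ext (by omega)
    have hcard := card_zeros_le n d c t (Finset.univ.image fun k => ((1 : ℝ), s k)) (by omega)
      hc ht ?_ ?_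
    · rw [Finset.card_image_of_injective _ fun k l e => hsinj (congrArg Prod.snd e),
        Finset.card_univ, Fintype.card_fin] at hcard
      omega
    · intro z hz
      obtain ⟨k, -, rfl⟩ := Finset.mem_image.1 hz
      simpa [hEa] using hs0 k
    · intro z hz z' hz' hzz
      obtain ⟨k, -, rfl⟩ := Finset.mem_image.1 hz
      obtain ⟨l, -, rfl⟩ := Finset.mem_image.1 hz'
      intro e
      simp only [one_mul] at e
      exact hzz (by rw [e])

/-- If sums of `r + 1` powers can be approximated by sums of `r` powers, then so can all forms. -/
theorem closure_powerSums_eq_univ {d r : ℕ}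
    (h : powerSums d (r + 1) ⊆ closure (powerSums d r)) : closure (powerSums d r) = Set.univ := by
  have hstep : ∀ g ∈ closure (powerSums d r), ∀ (c : ℝ) (L : ℝ × ℝ),
      g + c • powVec d L ∈ closure (powerSums d r) := fun g hg c L =>
    closure_minimal h isClosed_closure <|
      map_mem_closure (f := fun g => g + c • powVec d L) (by fun_prop) hg fun _ hf =>
        add_smul_powVec_mem_powerSums hf c L
  have hall : ∀ f : Fin (d + 1) → ℝ, ∀ c : ℝ, ∀ g ∈ closure (powerSums d r),
      g + c • f ∈ closure (powerSums d r) := fun f => by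
    have hf : f ∈ Submodule.span ℝ (Set.range fun t : ℝ => powVec d (t, (1 : ℝ))) := by
      simp [span_powVec_eq_top]
    induction hf using Submodule.span_induction with
    | mem x hx =>
      obtain ⟨t, rfl⟩ := hx
      exact fun c g hg => hstep g hg c _
    | zero => simp
    | add x y _ _ hx hy =>
      intro c g hg
      rw [smul_add, ← add_assoc]
      exact hy c _ (hx c g hg)
    | smul a x _ hx =>
      intro c g hg
      rw [smul_smul]
      exact hx _ g hg
  refine Set.eq_univ_of_forall fun f => ?_
  simpa using hall f 1 0 (subset_closure (zero_mem_powerSums d r))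

/-- For each `d ≥ 5`, the integer `d - 1` is a typical rank for real bivariate
degree-`d` forms. -/
theorem typical_rank_d_sub_one (d : ℕ) (hd : 5 ≤ d) : IsTypicalRank d (d - 1) := by
  obtain ⟨n, rfl⟩ : ∃ n, d = n + 2 := ⟨d - 2, by omega⟩
  have hnot : ¬ powerSums (n + 2) (n + 1) ⊆ closure (powerSums (n + 2) n) := fun h => by
    obtain ⟨U, hU, ⟨a, ha⟩, hdisj⟩ := exists_isOpen_disjoint_genericPowerSums (n := n) rfl
    have hmem : a ∈ closure (powerSums (n + 2) n) := by simp [closure_powerSums_eq_univ h]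
    have hmem' : a ∈ closure (genericPowerSums (n + 2) (n + 1)) :=
      closure_minimal ((powerSums_mono _ n.le_succ).trans
        (powerSums_subset_closure_genericPowerSums _ _)) isClosed_closure hmem
    exact Set.disjoint_left.1 (hdisj.closure_right hU) ha hmem'
  obtain ⟨f, hf, hfn⟩ := Set.not_subset.1 hnot
  obtain ⟨g, hg, hgen⟩ := mem_closure_iff.1
    (powerSums_subset_closure_genericPowerSums _ _ hf) _ isClosed_closure.isOpen_compl hfn
  refine ⟨interior (powerSums (n + 2) (n + 1)) ∩ (closure (powerSums (n + 2) n))ᶜ,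
    isOpen_interior.inter isClosed_closure.isOpen_compl,
    ⟨g, mem_interior_iff_mem_nhds.2 (powerSums_mem_𝓝 (by omega) hgen), hg⟩, ?_⟩
  rintro u ⟨hu, hun⟩
  have hu' := interior_subset hu
  refine le_antisymm (Nat.sInf_le hu') (le_csInf ⟨_, hu'⟩ fun r hr => ?_)
  by_contra! hlt
  exact hun (subset_closure (powerSums_mono _ (by omega : r ≤ n) hr))
end

section
/- Fix an odd integer d = 2m + 1 ≥ 5. Then 2m + 1 (that is, d itself) is a typical rank for real bivariate homogeneous forms of degree d; moreover it is attained on the open set of polynomials with d distinct real roots. -/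
/-- Evaluation of a coefficient vector as a bivariate form at `(x, y)`. -/
noncomputable def evalVec {K : Type*} [CommRing K] (d : ℕ) (f : Fin (d + 1) → K)
    (x y : K) : K :=
  ∑ i, f i * x ^ (i : ℕ) * y ^ (d - (i : ℕ))

/-- The value at the vector `v` of the linear form with coefficients `L`. -/
def linVal (L v : ℝ × ℝ) : ℝ := L.1 * v.1 + L.2 * v.2

/-- The determinant of the pair of vectors `u`, `v`. -/
def cross (u v : ℝ × ℝ) : ℝ := u.1 * v.2 - u.2 * v.1

lemma evalVec_powVec (d : ℕ) (L : ℝ × ℝ) (x y : ℝ) :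
    evalVec d (powVec d L) x y = (L.1 * x + L.2 * y) ^ d := by
  rw [add_pow, ← Fin.sum_univ_eq_sum_range
    (fun k => (L.1 * x) ^ k * (L.2 * y) ^ (d - k) * (d.choose k : ℝ))]
  refine Finset.sum_congr rfl fun i _ => ?_
  simp only [powVec, mul_pow]
  ring

lemma evalVec_sum_smul {ι : Type*} [Fintype ι] (d : ℕ) (c : ι → ℝ)
    (g : ι → Fin (d + 1) → ℝ) (x y : ℝ) :
    evalVec d (∑ k, c k • g k) x y = ∑ k, c k * evalVec d (g k) x y := by
  simp only [evalVec, Finset.sum_apply, Pi.smul_apply, smul_eq_mul, Finset.sum_mul, Finset.mul_sum]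
  rw [Finset.sum_comm]
  simp only [mul_assoc]

lemma evalVec_sub_smul (d : ℕ) (c : ℝ) (f g : Fin (d + 1) → ℝ) (x y : ℝ) :
    evalVec d (f - c • g) x y = evalVec d f x y - c * evalVec d g x y := by
  simp only [evalVec, Finset.mul_sum, ← Finset.sum_sub_distrib]
  refine Finset.sum_congr rfl fun i _ => ?_
  simp only [Pi.sub_apply, Pi.smul_apply, smul_eq_mul]
  ring

/-- A form of degree `d` vanishing at `d + 1` pairwise independent vectors is zero. -/
lemma eq_zero_of_evalVec_eq_zero {d : ℕ} {f : Fin (d + 1) → ℝ} {u : Fin (d + 1) → ℝ × ℝ}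
    (hu : ∀ i j, i ≠ j → cross (u i) (u j) ≠ 0)
    (hf : ∀ i, evalVec d f (u i).1 (u i).2 = 0) : f = 0 := by
  have hdet : (Matrix.projVandermonde (fun i => (u i).1) (fun i => (u i).2)).det ≠ 0 := by
    rw [Matrix.det_projVandermonde]
    refine Finset.prod_ne_zero_iff.2 fun i _ => Finset.prod_ne_zero_iff.2 fun j hj => ?_
    have h := hu j i (Finset.mem_Ioi.1 hj).ne'
    intro h0
    apply h
    simp only [cross]
    linarith
  refine Matrix.eq_zero_of_mulVec_eq_zero hdet ?_
  ext i
  rw [Pi.zero_apply, ← hf i]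
  simp only [Matrix.mulVec, dotProduct, Matrix.projVandermonde_apply, evalVec, Fin.val_rev]
  refine Finset.sum_congr rfl fun j _ => ?_
  rw [show d + 1 - ((j : ℕ) + 1) = d - j by omega]
  ring

/-- Two forms of degree `d` vanishing at the same `d` pairwise independent vectors are
proportional. -/
lemma eq_smul_of_common_roots {d : ℕ} {f g : Fin (d + 1) → ℝ} {u : Fin d → ℝ × ℝ} {P : ℝ × ℝ}
    (hu : ∀ i j, i ≠ j → cross (u i) (u j) ≠ 0) (hP : ∀ i, cross P (u i) ≠ 0)
    (hf : ∀ i, evalVec d f (u i).1 (u i).2 = 0) (hg : ∀ i, evalVec d g (u i).1 (u i).2 = 0)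
    (hgP : evalVec d g P.1 P.2 ≠ 0) :
    f = (evalVec d f P.1 P.2 / evalVec d g P.1 P.2) • g := by
  rw [← sub_eq_zero]
  have hanti : ∀ a b, cross a b = - cross b a := fun a b => by simp only [cross]; ring
  refine eq_zero_of_evalVec_eq_zero (u := Fin.cons P u) ?_ ?_
  · intro i j
    refine Fin.cases ?_ (fun i => ?_) i <;> refine Fin.cases ?_ (fun j => ?_) j
    · simp
    · intro _
      simpa using hP j
    · intro _
      rw [hanti]
      simpa using hP i
    · intro h
      simpa using hu i j fun h' => h (by rw [h'])
  · intro i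
    rw [evalVec_sub_smul]
    refine Fin.cases ?_ (fun i => ?_) i
    · simp only [Fin.cons_zero]
      field_simp
      ring
    · simp [hf i, hg i]

/-- A product of `n` linear forms is a form of degree `n`. -/
lemma exists_evalVec_eq_prod (n : ℕ) (L : Fin n → ℝ × ℝ) :
    ∃ g : Fin (n + 1) → ℝ, ∀ x y, evalVec n g x y = ∏ i, ((L i).1 * x + (L i).2 * y) := by
  suffices h : ∃ g : ℕ → ℝ, (∀ i, n < i → g i = 0) ∧
      ∀ x y, ∑ i ∈ Finset.range (n + 1), g i * x ^ i * y ^ (n - i)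
        = ∏ i, ((L i).1 * x + (L i).2 * y) by
    obtain ⟨g, -, hg⟩ := h
    refine ⟨fun i => g i, fun x y => ?_⟩
    rw [← hg, ← Fin.sum_univ_eq_sum_range (fun i => g i * x ^ i * y ^ (n - i))]
    rfl
  induction n with
  | zero => exact ⟨fun i => if i = 0 then 1 else 0, fun i hi => by simp [hi.ne'], by simp⟩
  | succ n ih =>
    obtain ⟨g, hg0, hg⟩ := ih fun i => L i.succ
    let s : ℕ → ℝ := fun i => Nat.casesOn i 0 g
    refine ⟨fun i => (L 0).2 * g i + (L 0).1 * s i, fun i hi => ?_, fun x y => ?_⟩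
    · obtain ⟨k, rfl⟩ : ∃ k, i = k + 1 := ⟨i - 1, by omega⟩
      simp [s, hg0 (k + 1) (by omega), hg0 k (by omega)]
    · rw [Fin.prod_univ_succ, ← hg x y]
      have h1 : ∑ i ∈ Finset.range (n + 1 + 1), g i * x ^ i * y ^ (n + 1 - i)
          = y * ∑ i ∈ Finset.range (n + 1), g i * x ^ i * y ^ (n - i) := by
        rw [Finset.sum_range_succ, hg0 (n + 1) (by omega), Finset.mul_sum]
        simp only [zero_mul, add_zero]
        refine Finset.sum_congr rfl fun i hi => ?_
        rw [show n + 1 - i = n - i + 1 by have := Finset.mem_range.1 hi; omega, pow_succ]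
        ring
      have h2 : ∑ i ∈ Finset.range (n + 1 + 1), s i * x ^ i * y ^ (n + 1 - i)
          = x * ∑ i ∈ Finset.range (n + 1), g i * x ^ i * y ^ (n - i) := by
        have s0 : s 0 = 0 := rfl
        have ss : ∀ i, s (i + 1) = g i := fun _ => rfl
        rw [Finset.sum_range_succ', Finset.mul_sum]
        simp only [s0, ss, zero_mul, add_zero]
        refine Finset.sum_congr rfl fun i _ => ?_
        rw [show n + 1 - (i + 1) = n - i by omega, pow_succ]
        ring
      simp only [add_mul, mul_assoc, Finset.sum_add_distrib, ← Finset.mul_sum] at h1 h2 ⊢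
      rw [h1, h2]
      ring

/-- Finitely many nonzero linear forms have a common non-root. -/
lemma exists_forall_linVal_ne_zero {ι : Type*} [Fintype ι] (L : ι → ℝ × ℝ)
    (hL : ∀ i, L i ≠ 0) : ∃ v, ∀ i, linVal (L i) v ≠ 0 := by
  have hne : ∏ i, (Polynomial.C (L i).1 * Polynomial.X + Polynomial.C (L i).2) ≠ 0 := by
    refine Finset.prod_ne_zero_iff.2 fun i _ h => hL i ?_
    have h0 := congrArg (Polynomial.coeff · 0) h
    have h1 := congrArg (Polynomial.coeff · 1) h
    simp at h0 h1
    exact Prod.ext h1 h0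
  obtain ⟨t, ht⟩ : ∃ t, Polynomial.eval t
      (∏ i, (Polynomial.C (L i).1 * Polynomial.X + Polynomial.C (L i).2)) ≠ 0 := by
    by_contra! h
    exact hne (Polynomial.funext fun t => by simpa using h t)
  rw [Polynomial.eval_prod, Finset.prod_ne_zero_iff] at ht
  exact ⟨(t, 1), fun i => by simpa [linVal] using ht i (Finset.mem_univ i)⟩

lemma cross_ne_zero_of_not_areProportional {u v : ℝ × ℝ} (hu : u ≠ 0)
    (h : ¬ AreProportional u v) : cross u v ≠ 0 := by
  intro h0
  apply h
  simp only [cross] at h0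
  by_cases h1 : u.1 = 0
  · have h2 : u.2 ≠ 0 := fun h2 => hu (Prod.ext h1 h2)
    refine ⟨v.2 / u.2, Or.inl (Prod.ext ?_ ?_)⟩
    · simp only [Prod.smul_fst, smul_eq_mul]
      field_simp
      linarith
    · simp only [Prod.smul_snd, smul_eq_mul]
      field_simp
  · refine ⟨v.1 / u.1, Or.inl (Prod.ext ?_ ?_)⟩
    · simp only [Prod.smul_fst, smul_eq_mul]
      field_simp
    · simp only [Prod.smul_snd, smul_eq_mul]
      field_simp
      linarith

lemma not_areProportional_of_cross_ne_zero {u v : ℝ × ℝ} (h : cross u v ≠ 0) :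
    ¬ AreProportional u v := by
  rintro ⟨t, rfl | rfl⟩ <;> exact h (by simp [cross]; ring)

lemma exists_ne_zero_linVal_eq_zero (L : ℝ × ℝ) : ∃ a : ℝ × ℝ, a ≠ 0 ∧ linVal L a = 0 := by
  by_cases h : L = 0
  · exact ⟨(1, 0), by simp, by simp [h, linVal]⟩
  · refine ⟨(L.2, -L.1), fun h0 => h ?_, by simp only [linVal]; ring⟩
    simp only [Prod.mk_eq_zero, neg_eq_zero] at h0
    exact Prod.ext h0.2 h0.1

lemma linVal_add_smul (L a b : ℝ × ℝ) (s t : ℝ) :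
    linVal L (s • a + t • b) = s * linVal L a + t * linVal L b := by
  simp only [linVal, Prod.fst_add, Prod.snd_add, Prod.smul_fst, Prod.smul_snd, smul_eq_mul]
  ring

/-- A sum of powers of linear forms vanishing on an affine line off the origin is zero. -/
lemma sum_pow_eq_zero_of_line {r : ℕ} (d : ℕ) (c : Fin r → ℝ) (L : Fin r → ℝ × ℝ) {a b : ℝ × ℝ}
    (hab : ∀ v : ℝ × ℝ, ∃ s t : ℝ, v = s • a + t • b)
    (h : ∀ t : ℝ, ∑ i, c i * linVal (L i) (t • a + b) ^ d = 0) (v : ℝ × ℝ) :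
    ∑ i, c i * linVal (L i) v ^ d = 0 := by
  obtain ⟨s, t, rfl⟩ := hab v
  have hcont : Continuous fun t : ℝ => ∑ i, c i * linVal (L i) (s • a + t • b) ^ d := by
    simp only [linVal_add_smul]
    fun_prop
  have hext := Continuous.ext_on (dense_compl_singleton (0 : ℝ)) hcont
    (continuous_const (y := (0 : ℝ))) fun t ht => ?_
  · exact congrFun hext t
  · have ht : t ≠ 0 := ht
    have key : ∀ i, linVal (L i) (s • a + t • b) = t * linVal (L i) ((s / t) • a + b) := by
      intro i
      have h1 := linVal_add_smul (L i) a b (s / t) 1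
      rw [one_smul] at h1
      rw [linVal_add_smul, h1]
      field_simp
    have h2 := h (s / t)
    simp only [key, mul_pow]
    rw [← mul_zero (t ^ d), ← h2, Finset.mul_sum]
    exact Finset.sum_congr rfl fun i _ => by ring

/-- A sum of `r < d` powers of degree `d` of real linear forms that vanishes at `d` pairwise
independent vectors is identically zero. -/
lemma sum_pow_eq_zero_of_roots (r : ℕ) : ∀ (d : ℕ) (c : Fin r → ℝ) (L : Fin r → ℝ × ℝ)
    (S : Finset (ℝ × ℝ)), r < d → d ≤ S.card →
    (∀ u ∈ S, ∀ v ∈ S, u ≠ v → cross u v ≠ 0) →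
    (∀ u ∈ S, ∑ i, c i * linVal (L i) u ^ d = 0) →
    ∀ v, ∑ i, c i * linVal (L i) v ^ d = 0 := by
  classical
  induction r with
  | zero => intros; simp
  | succ r ih =>
    intro d c L S hrd hdS hS hroot
    obtain ⟨e, rfl⟩ : ∃ e, d = e + 1 := ⟨d - 1, by omega⟩
    obtain ⟨a, ha, hLa⟩ := exists_ne_zero_linVal_eq_zero (L (Fin.last r))
    set b : ℝ × ℝ := (-a.2, a.1) with hb
    set N : ℝ := a.1 ^ 2 + a.2 ^ 2 with hN
    have hNpos : N ≠ 0 := by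
      intro h
      exact ha (Prod.ext (by simp; nlinarith [sq_nonneg a.1, sq_nonneg a.2])
        (by simp; nlinarith [sq_nonneg a.1, sq_nonneg a.2]))
    have hdecomp : ∀ v : ℝ × ℝ,
        v = ((a.1 * v.1 + a.2 * v.2) / N) • a + (cross a v / N) • b := by
      intro v
      refine Prod.ext ?_ ?_ <;> simp [hb, cross] <;> field_simp <;> rw [hN] <;> ring
    have hab : ∀ v : ℝ × ℝ, ∃ s t : ℝ, v = s • a + t • b := fun v => ⟨_, _, hdecomp v⟩
    have hline : ∀ i (t : ℝ), linVal (L i) (t • a + b) =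
        t * linVal (L i) a + linVal (L i) b := by
      intro i t
      simpa using linVal_add_smul (L i) a b t 1
    set p : Polynomial ℝ := ∑ i, Polynomial.C (c i) *
      (Polynomial.C (linVal (L i) a) * Polynomial.X + Polynomial.C (linVal (L i) b)) ^ (e + 1)
      with hp
    have hpeval : ∀ t, p.eval t = ∑ i, c i * linVal (L i) (t • a + b) ^ (e + 1) := by
      intro t
      simp [hp, Polynomial.eval_finsetSum, hline, mul_comm t]
    have hdeval : ∀ t, p.derivative.eval t = (e + 1) *
        ∑ i : Fin r, (c i.castSucc * linVal (L i.castSucc) a) *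
          linVal (L i.castSucc) (t • a + b) ^ e := by
      intro t
      simp [hp, Polynomial.eval_finsetSum, hline,
        Polynomial.derivative_pow, Fin.sum_univ_castSucc, hLa, Finset.mul_sum]
      refine Finset.sum_congr rfl fun i _ => ?_
      ring
    by_cases hp0 : p = 0
    · refine sum_pow_eq_zero_of_line (e + 1) c L hab fun t => ?_
      rw [← hpeval, hp0, Polynomial.eval_zero]
    exfalso
    have hSne : ∀ u ∈ S, u ≠ 0 := by
      rintro u hu rfl
      obtain ⟨w, hw, hne⟩ := Finset.exists_mem_ne (s := S) (by omega) (0 : ℝ × ℝ)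
      exact hS w hw 0 hu hne (by simp [cross])
    set S₁ := S.filter fun u => cross a u ≠ 0 with hS₁
    set S₀ := S.filter fun u => ¬ cross a u ≠ 0 with hS₀
    have hcard : S₁.card + S₀.card = S.card := Finset.card_filter_add_card_filter_not _
    have hscale : ∀ u, cross a u = 0 → u = ((a.1 * u.1 + a.2 * u.2) / N) • a := by
      intro u h0
      have := hdecomp u
      rwa [h0, zero_div, zero_smul, add_zero] at this
    have hS₀card : S₀.card ≤ 1 := by
      refine Finset.card_le_one.2 fun u hu v hv => ?_
      by_contra huv
      simp only [hS₀, Finset.mem_filter, not_not] at hu hv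
      refine hS u hu.1 v hv.1 huv ?_
      rw [hscale u hu.2, hscale v hv.2]
      simp only [cross, Prod.smul_fst, Prod.smul_snd, smul_eq_mul]
      ring
    let τ : ℝ × ℝ → ℝ := fun u => (a.1 * u.1 + a.2 * u.2) / cross a u
    have hτ : ∀ u, cross a u ≠ 0 → u = (cross a u / N) • (τ u • a + b) := by
      intro u hu
      conv_lhs => rw [hdecomp u]
      rw [smul_add, smul_smul]
      congr 2
      simp only [τ]
      field_simp
    have hτinj : Set.InjOn τ S₁ := by
      intro u hu v hv huv
      by_contra hne
      simp only [hS₁, Finset.coe_filter, Set.mem_ofPred_eq] at hu hv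
      refine hS u hu.1 v hv.1 hne ?_
      rw [hτ u hu.2, hτ v hv.2, huv]
      simp only [cross, Prod.smul_fst, Prod.smul_snd, smul_eq_mul]
      ring
    have hτroot : S₁.image τ ⊆ p.roots.toFinset := by
      intro t ht
      obtain ⟨u, hu, rfl⟩ := Finset.mem_image.1 ht
      simp only [hS₁, Finset.mem_filter] at hu
      rw [Multiset.mem_toFinset, Polynomial.mem_roots hp0, Polynomial.IsRoot.def, hpeval]
      have h0 := hroot u hu.1
      rw [hτ u hu.2] at h0
      have hl : ∀ i, linVal (L i) ((cross a u / N) • (τ u • a + b)) =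
          (cross a u / N) * linVal (L i) (τ u • a + b) := by
        intro i
        simpa using linVal_add_smul (L i) (τ u • a + b) 0 (cross a u / N) 0
      simp only [hl, mul_pow, mul_left_comm (c _), ← Finset.mul_sum] at h0
      exact (mul_eq_zero.1 h0).resolve_left (pow_ne_zero _ (div_ne_zero hu.2 hNpos))
    have hcard₁ : S₁.card ≤ p.roots.toFinset.card := by
      rw [← Finset.card_image_of_injOn hτinj]
      exact Finset.card_le_card hτroot
    have hrolle := p.card_roots_toFinset_le_derivative
    let R := p.derivative.roots.toFinset.image fun t => t • a + b
    have hcrossb : ∀ s t : ℝ, cross (s • a + b) (t • a + b) = (s - t) * N := by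
      intro s t
      simp [cross, hb, hN]
      ring
    have hcrossa : ∀ t : ℝ, cross a (t • a + b) = N := by
      intro t
      simp [cross, hb, hN]
      ring
    have hRcard : R.card = p.derivative.roots.toFinset.card := by
      refine Finset.card_image_of_injective _ fun s t hst => ?_
      have h1 := hcrossb s t
      rw [hst, hcrossb, sub_self, zero_mul] at h1
      exact sub_eq_zero.1 ((mul_eq_zero.1 h1.symm).resolve_right hNpos)
    have hdisj : Disjoint R S₀ := by
      rw [Finset.disjoint_left]
      intro u hu hu'
      obtain ⟨t, -, rfl⟩ := Finset.mem_image.1 hu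
      simp only [hS₀, Finset.mem_filter, not_not, hcrossa] at hu'
      exact hNpos hu'.2
    have hDzero := ih e (fun i => c i.castSucc * linVal (L i.castSucc) a)
      (fun i => L i.castSucc) (R ∪ S₀) (by omega)
      (by rw [Finset.card_union_of_disjoint hdisj]; omega) ?_ ?_
    · have hder : p.derivative = 0 := by
        refine Polynomial.funext fun t => ?_
        rw [hdeval, hDzero, mul_zero, Polynomial.eval_zero]
      obtain ⟨u, hu⟩ : (S₁.image τ).Nonempty := by
        rw [Finset.image_nonempty, ← Finset.card_pos]
        omega
      have hu := hτroot hu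
      rw [Multiset.mem_toFinset, Polynomial.mem_roots hp0, Polynomial.IsRoot.def] at hu
      have hC := Polynomial.eq_C_of_derivative_eq_zero hder
      rw [hC, Polynomial.eval_C] at hu
      rw [hu, Polynomial.C_0] at hC
      exact hp0 hC
    · have hS₀R : ∀ u ∈ S₀, ∀ v ∈ R, cross u v ≠ 0 := by
        intro u hu v hv
        obtain ⟨t, -, rfl⟩ := Finset.mem_image.1 hv
        have huS := (Finset.mem_filter.1 hu).1
        have hu0 := not_not.1 (Finset.mem_filter.1 hu).2
        have hune := hSne u huS
        rw [hscale u hu0] at hune ⊢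
        have hs := (smul_ne_zero_iff.1 hune).1
        set s := (a.1 * u.1 + a.2 * u.2) / N
        have : cross (s • a) (t • a + b) = s * cross a (t • a + b) := by
          simp only [cross, Prod.smul_fst, Prod.smul_snd, smul_eq_mul]
          ring
        rw [this, hcrossa]
        exact mul_ne_zero hs hNpos
      intro u hu v hv huv
      rcases Finset.mem_union.1 hu with hu | hu <;> rcases Finset.mem_union.1 hv with hv | hv
      · obtain ⟨s, -, rfl⟩ := Finset.mem_image.1 hu
        obtain ⟨t, -, rfl⟩ := Finset.mem_image.1 hv
        rw [hcrossb]
        exact mul_ne_zero (sub_ne_zero.2 fun h => huv (by rw [h])) hNpos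
      · have h := hS₀R v hv u hu
        intro h0
        apply h
        simp only [cross] at h0 ⊢
        linarith
      · exact hS₀R u hu v hv
      · exact hS u (Finset.mem_filter.1 hu).1 v (Finset.mem_filter.1 hv).1 huv
    · intro u hu
      rcases Finset.mem_union.1 hu with hu | hu
      · obtain ⟨t, ht, rfl⟩ := Finset.mem_image.1 hu
        have ht := (Polynomial.mem_roots'.1 (Multiset.mem_toFinset.1 ht)).2
        rw [Polynomial.IsRoot.def, hdeval] at ht
        exact (mul_eq_zero.1 ht).resolve_left (by positivity)
      · have huS := (Finset.mem_filter.1 hu).1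
        have hu0 := not_not.1 (Finset.mem_filter.1 hu).2
        have hune := hSne u huS
        have h0 := hroot u huS
        rw [hscale u hu0] at hune h0 ⊢
        have hs := (smul_ne_zero_iff.1 hune).1
        set s := (a.1 * u.1 + a.2 * u.2) / N
        have hl : ∀ i, linVal (L i) (s • a) = s * linVal (L i) a := by
          intro i
          simpa using linVal_add_smul (L i) a 0 s 0
        rw [Fin.sum_univ_castSucc] at h0
        simp only [hl, hLa, mul_zero, zero_pow (Nat.succ_ne_zero e), add_zero] at h0
        refine (mul_eq_zero.1 ?_).resolve_left hs
        rw [← h0, Finset.mul_sum]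
        refine Finset.sum_congr rfl fun i _ => ?_
        rw [hl]
        ring

/-- The forms of degree `d` that are a nonzero multiple of a product of `d` pairwise
non-proportional real linear forms. -/
def distinctRealRoots (d : ℕ) : Set (Fin (d + 1) → ℝ) :=
  {f | ∃ (c : ℝ) (L : Fin d → ℝ × ℝ), c ≠ 0 ∧ (∀ i, L i ≠ 0) ∧
    (∀ i j, i ≠ j → ¬ AreProportional (L i) (L j)) ∧
    ∀ x y : ℝ, evalVec d f x y = c * ∏ i, ((L i).1 * x + (L i).2 * y)}

lemma distinctRealRoots_nonempty (d : ℕ) : (distinctRealRoots d).Nonempty := by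
  obtain ⟨g, hg⟩ := exists_evalVec_eq_prod d fun i => (1, (i : ℝ))
  refine ⟨g, 1, fun i => (1, (i : ℝ)), one_ne_zero, fun i h => ?_, fun i j hij => ?_,
    by simpa using hg⟩
  · simpa using congrArg Prod.fst h
  · apply not_areProportional_of_cross_ne_zero
    simp only [cross, one_mul, mul_one]
    rw [sub_ne_zero]
    exact fun h => hij (Fin.ext (Nat.cast_injective h).symm)

/-- Sufficient condition for a nonzero form to split, in terms of its zeros. -/
lemma mem_distinctRealRoots_of_roots {d : ℕ} (hd : 2 ≤ d) {f : Fin (d + 1) → ℝ}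
    {u : Fin d → ℝ × ℝ} (hu : ∀ i j, i ≠ j → cross (u i) (u j) ≠ 0)
    (hroot : ∀ i, evalVec d f (u i).1 (u i).2 = 0) (hf : f ≠ 0) : f ∈ distinctRealRoots d := by
  let L : Fin d → ℝ × ℝ := fun i => (-(u i).2, (u i).1)
  have hL : ∀ i, L i ≠ 0 := by
    intro i h0
    have : Nontrivial (Fin d) := Fin.nontrivial_iff_two_le.2 hd
    obtain ⟨j, hj⟩ := exists_ne i
    refine hu i j hj.symm ?_
    have h1 := congrArg Prod.fst h0
    have h2 := congrArg Prod.snd h0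
    simp only [L, Prod.fst_zero, Prod.snd_zero, neg_eq_zero] at h1 h2
    simp [cross, h1, h2]
  obtain ⟨g, hg⟩ := exists_evalVec_eq_prod d L
  obtain ⟨P, hP⟩ := exists_forall_linVal_ne_zero L hL
  have hgP : evalVec d g P.1 P.2 ≠ 0 := by
    rw [hg]
    exact Finset.prod_ne_zero_iff.2 fun i _ => hP i
  have hfg := eq_smul_of_common_roots (P := P) hu (fun i h => hP i ?_) hroot
    (fun i => ?_) hgP
  · refine ⟨evalVec d f P.1 P.2 / evalVec d g P.1 P.2, L, fun h0 => hf ?_, hL, ?_, fun x y => ?_⟩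
    · rw [hfg, h0, zero_smul]
    · intro i j hij
      apply not_areProportional_of_cross_ne_zero
      intro h
      apply hu i j hij
      simp only [cross, L] at h ⊢
      linarith
    · have h := evalVec_sub_smul d (evalVec d f P.1 P.2 / evalVec d g P.1 P.2) f g x y
      rw [← hfg, sub_self] at h
      rw [← hg, ← sub_eq_zero, ← h]
      simp [evalVec]
  · simp only [cross] at h
    simp only [linVal, L]
    linarith
  · rw [hg]
    exact Finset.prod_eq_zero (Finset.mem_univ i) (by simp only [L]; ring)

lemma continuous_evalVec_left (d : ℕ) (x y : ℝ) :
    Continuous fun f : Fin (d + 1) → ℝ => evalVec d f x y := by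
  unfold evalVec
  fun_prop

lemma continuous_evalVec_right (d : ℕ) (f : Fin (d + 1) → ℝ) :
    Continuous fun v : ℝ × ℝ => evalVec d f v.1 v.2 := by
  unfold evalVec
  fun_prop

/-- Simple real zeros persist under small perturbations of the form. -/
lemma eventually_exists_root_near {d : ℕ} {f : Fin (d + 1) → ℝ} {v w : ℝ × ℝ} {A : ℝ → ℝ}
    (hA : Continuous A) (hA0 : A 0 ≠ 0)
    (hf : ∀ t : ℝ, evalVec d f (v + t • w).1 (v + t • w).2 = t * A t) {ε : ℝ} (hε : 0 < ε) :
    ∀ᶠ g in nhds f, ∃ u ∈ Metric.ball v ε, evalVec d g u.1 u.2 = 0 := by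
  have hA2 : ∀ᶠ t in nhds (0 : ℝ), 0 < A t * A (-t) := by
    have hc : Continuous fun t => A t * A (-t) := by fun_prop
    refine hc.continuousAt.eventually_mem (Ioi_mem_nhds ?_)
    simpa using mul_self_pos.2 hA0
  have hball : ∀ᶠ t in nhds (0 : ℝ), v + t • w ∈ Metric.ball v ε := by
    have hc : Continuous fun t : ℝ => v + t • w := by fun_prop
    refine hc.continuousAt.eventually_mem (Metric.isOpen_ball.mem_nhds ?_)
    simpa using hε
  obtain ⟨δ, hδ, hδ'⟩ := Metric.eventually_nhds_iff.1 (hA2.and hball)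
  have ht : |δ / 2| < δ := by rw [abs_of_pos (by positivity)]; linarith
  have hAt := (hδ' (y := δ / 2) (by rwa [Real.dist_eq, sub_zero])).1
  have hsign : evalVec d f (v + (δ / 2) • w).1 (v + (δ / 2) • w).2 *
      evalVec d f (v + (-(δ / 2)) • w).1 (v + (-(δ / 2)) • w).2 < 0 := by
    rw [hf, hf]
    have : 0 < (δ / 2) ^ 2 * (A (δ / 2) * A (-(δ / 2))) := by positivity
    linarith
  have hcont : Continuous fun g : Fin (d + 1) → ℝ =>
      evalVec d g (v + (δ / 2) • w).1 (v + (δ / 2) • w).2 *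
      evalVec d g (v + (-(δ / 2)) • w).1 (v + (-(δ / 2)) • w).2 :=
    (continuous_evalVec_left _ _ _).mul (continuous_evalVec_left _ _ _)
  filter_upwards [hcont.continuousAt.eventually_mem (Iio_mem_nhds hsign)] with g hg
  have hG : Continuous fun t : ℝ => evalVec d g (v + t • w).1 (v + t • w).2 :=
    (continuous_evalVec_right d g).comp (by fun_prop : Continuous fun t : ℝ => v + t • w)
  obtain ⟨t, ht, ht0⟩ : (0 : ℝ) ∈ (fun t : ℝ => evalVec d g (v + t • w).1 (v + t • w).2) ''
      Set.uIcc (-(δ / 2)) (δ / 2) := by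
    refine intermediate_value_uIcc hG.continuousOn ?_
    rw [Set.mem_uIcc]
    rcases mul_neg_iff.1 (Set.mem_Iio.1 hg) with h | h
    · exact Or.inl ⟨h.2.le, h.1.le⟩
    · exact Or.inr ⟨h.1.le, h.2.le⟩
  refine ⟨v + t • w, (hδ' ?_).2, ht0⟩
  rw [Set.uIcc_of_le (by linarith)] at ht
  rw [Real.dist_eq, sub_zero, abs_lt]
  constructor <;> linarith [ht.1, ht.2]

lemma isOpen_distinctRealRoots {d : ℕ} (hd : 2 ≤ d) : IsOpen (distinctRealRoots d) := by
  rw [isOpen_iff_eventually]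
  rintro f ⟨c, L, hc, hL, hLL, hfac⟩
  let v : Fin d → ℝ × ℝ := fun i => ((L i).2, -(L i).1)
  have hcross : ∀ i j, i ≠ j → cross (v i) (v j) ≠ 0 := by
    intro i j hij h
    apply cross_ne_zero_of_not_areProportional (hL i) (hLL i j hij)
    simp only [cross, v] at h ⊢
    linarith
  have hopen : ∀ᶠ u in nhds v, ∀ i j, i ≠ j → cross (u i) (u j) ≠ 0 := by
    refine Filter.eventually_all.2 fun i => Filter.eventually_all.2 fun j => ?_
    by_cases hij : i = j
    · simp [hij]
    · have hcont : Continuous fun u : Fin d → ℝ × ℝ => cross (u i) (u j) := by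
        unfold cross
        fun_prop
      filter_upwards [hcont.continuousAt.eventually_ne (hcross i j hij)] with u hu _ using hu
  obtain ⟨ε, hε, hball⟩ := Metric.eventually_nhds_iff.1 hopen
  have hroots : ∀ᶠ g in nhds f, ∀ i, ∃ u ∈ Metric.ball (v i) ε, evalVec d g u.1 u.2 = 0 := by
    refine Filter.eventually_all.2 fun i => ?_
    let A : ℝ → ℝ := fun t => c * ((L i).1 ^ 2 + (L i).2 ^ 2) *
      ∏ j ∈ Finset.univ.erase i, linVal (L j) (v i + t • L i)
    refine eventually_exists_root_near (w := L i) (A := A) ?_ ?_ (fun t => ?_) hε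
    · simp only [A, linVal]
      fun_prop
    · refine mul_ne_zero (mul_ne_zero hc fun h => hL i ?_)
        (Finset.prod_ne_zero_iff.2 fun j hj h => ?_)
      · exact Prod.ext (by simp; nlinarith [sq_nonneg (L i).1, sq_nonneg (L i).2])
          (by simp; nlinarith [sq_nonneg (L i).1, sq_nonneg (L i).2])
      · refine hcross i j (Finset.ne_of_mem_erase hj).symm ?_
        simp only [linVal, v, zero_smul, add_zero] at h
        simp only [cross, v]
        linarith
    · rw [hfac, ← Finset.mul_prod_erase _ _ (Finset.mem_univ i)]
      simp only [A, linVal, v, Prod.fst_add, Prod.snd_add, Prod.smul_fst, Prod.smul_snd,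
        smul_eq_mul]
      ring
  have hne : f ≠ 0 := by
    rintro rfl
    obtain ⟨P, hP⟩ := exists_forall_linVal_ne_zero L hL
    refine mul_ne_zero hc (Finset.prod_ne_zero_iff.2 fun i _ => hP i) ((hfac P.1 P.2).symm.trans ?_)
    simp [evalVec]
  filter_upwards [hroots, eventually_ne_nhds hne] with g hg hg0
  choose u hu hu0 using hg
  exact mem_distinctRealRoots_of_roots hd (hball ((dist_pi_lt_iff hε).2 hu)) hu0 hg0

/-- For odd `d`, a form with `d` distinct real roots is a combination of the `d`-th powers of
its own linear factors. -/
lemma exists_eq_sum_powVec {d : ℕ} (hd : Odd d) {f : Fin (d + 1) → ℝ}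
    (hf : f ∈ distinctRealRoots d) :
    ∃ (c : Fin d → ℝ) (L : Fin d → ℝ × ℝ), f = ∑ i, c i • powVec d (L i) := by
  obtain ⟨c, L, hc, hL, hLL, hfac⟩ := hf
  suffices h : f ∈ Submodule.span ℝ (Set.range fun i => powVec d (L i)) by
    obtain ⟨b, hb⟩ := (Submodule.mem_span_range_iff_exists_fun ℝ).1 h
    exact ⟨b, L, hb.symm⟩
  by_contra hnot
  obtain ⟨φ, hφf, hφ⟩ := Submodule.exists_le_ker_of_notMem hnot
  apply hφf
  have hφsum : ∀ g, φ g = ∑ i, g i * φ (Pi.single i 1) := by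
    intro g
    conv_lhs => rw [← Finset.univ_sum_single g, map_sum]
    refine Finset.sum_congr rfl fun i _ => ?_
    rw [← smul_eq_mul, ← map_smul, ← Pi.single_smul, smul_eq_mul, mul_one]
  let k : Fin (d + 1) → ℝ := fun i => d.choose i * φ (Pi.single i 1)
  let g : Fin (d + 1) → ℝ := fun i => (-1) ^ (i : ℕ) * f i.rev
  have hk : ∀ i, evalVec d k (L i).1 (L i).2 = 0 := by
    intro i
    have h0 : φ (powVec d (L i)) = 0 := hφ (Submodule.subset_span ⟨i, rfl⟩)
    rw [hφsum] at h0
    rw [← h0]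
    refine Finset.sum_congr rfl fun j _ => ?_
    simp only [k, powVec]
    ring
  have hg : ∀ x y, evalVec d g x y = evalVec d f y (-x) := by
    intro x y
    simp only [evalVec]
    rw [← Equiv.sum_comp Fin.revPerm]
    refine Finset.sum_congr rfl fun i _ => ?_
    have hi : d - (d - (i : ℕ)) = i := by omega
    simp only [g, Fin.revPerm_apply, Fin.rev_rev, Fin.val_rev, Nat.add_sub_add_right, hi]
    rw [neg_pow x]
    ring
  have hcross : ∀ i j, i ≠ j → cross (L i) (L j) ≠ 0 := fun i j hij =>
    cross_ne_zero_of_not_areProportional (hL i) (hLL i j hij)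
  obtain ⟨Q, hQ⟩ := exists_forall_linVal_ne_zero L hL
  have hkg := eq_smul_of_common_roots (P := (-Q.2, Q.1)) hcross (fun i h => hQ i ?_) hk
    (fun i => ?_) (g := g) ?_
  · set s := evalVec d k (-Q.2, Q.1).1 (-Q.2, Q.1).2 / evalVec d g (-Q.2, Q.1).1 (-Q.2, Q.1).2
    have hφi : ∀ i : Fin (d + 1),
        φ (Pi.single i 1) = s * ((-1) ^ (i : ℕ) * f i.rev) / d.choose i := by
      intro i
      have hch : (d.choose i : ℝ) ≠ 0 := by
        exact_mod_cast (Nat.choose_pos (Nat.lt_succ_iff.1 i.2)).ne'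
      rw [eq_div_iff hch, mul_comm]
      exact congrFun hkg i
    have hanti : φ f = - φ f := by
      conv_lhs => rw [hφsum, ← Equiv.sum_comp Fin.revPerm]
      rw [hφsum f, ← Finset.sum_neg_distrib]
      refine Finset.sum_congr rfl fun i _ => ?_
      have hi : (i : ℕ) ≤ d := Nat.lt_succ_iff.1 i.2
      have hsgn : (-1 : ℝ) ^ (d - (i : ℕ)) = - (-1) ^ (i : ℕ) := by
        have h1 : (-1 : ℝ) ^ (d - (i : ℕ)) * (-1) ^ (i : ℕ) = -1 := by
          rw [← pow_add, Nat.sub_add_cancel hi, hd.neg_one_pow]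
        have h2 : (-1 : ℝ) ^ (i : ℕ) * (-1) ^ (i : ℕ) = 1 := by
          rw [← mul_pow]; simp
        linear_combination (-1 : ℝ) ^ (i : ℕ) * h1 - (-1 : ℝ) ^ (d - (i : ℕ)) * h2
      simp only [hφi, Fin.revPerm_apply, Fin.rev_rev, Fin.val_rev, Nat.add_sub_add_right,
        Nat.choose_symm hi, hsgn]
      ring
    linarith
  · simp only [cross] at h
    simp only [linVal]
    linarith
  · rw [hg, hfac]
    rw [Finset.prod_eq_zero (Finset.mem_univ i) (by ring), mul_zero]
  · rw [hg, hfac]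
    refine mul_ne_zero hc (Finset.prod_ne_zero_iff.2 fun i _ => ?_)
    simpa [linVal] using hQ i

/-- A form with `d` distinct real roots is not a combination of fewer than `d` real powers. -/
lemma le_of_eq_sum_powVec {d r : ℕ} {f : Fin (d + 1) → ℝ} (hf : f ∈ distinctRealRoots d)
    {b : Fin r → ℝ} {M : Fin r → ℝ × ℝ} (hsum : f = ∑ i, b i • powVec d (M i)) : d ≤ r := by
  classical
  by_contra! hr
  obtain ⟨c, L, hc, hL, hLL, hfac⟩ := hf
  have hval : ∀ v : ℝ × ℝ, evalVec d f v.1 v.2 = ∑ i, b i * linVal (M i) v ^ d := by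
    intro v
    rw [hsum, evalVec_sum_smul]
    simp only [evalVec_powVec, linVal]
  let v : Fin d → ℝ × ℝ := fun i => ((L i).2, -(L i).1)
  have hcross : ∀ i j, i ≠ j → cross (v i) (v j) ≠ 0 := by
    intro i j hij h
    apply cross_ne_zero_of_not_areProportional (hL i) (hLL i j hij)
    simp only [cross, v] at h ⊢
    linarith
  have hinj : Function.Injective v := by
    intro i j hij
    by_contra hne
    apply hcross i j hne
    rw [hij]
    simp only [cross]
    ring
  have hzero := sum_pow_eq_zero_of_roots r d b M (Finset.univ.image v) hr
    (by simp [Finset.card_image_of_injective _ hinj]) ?_ ?_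
  · obtain ⟨P, hP⟩ := exists_forall_linVal_ne_zero L hL
    refine mul_ne_zero hc (Finset.prod_ne_zero_iff.2 fun i _ => hP i) ((hfac P.1 P.2).symm.trans ?_)
    rw [hval, hzero]
  · intro u hu w hw huw
    obtain ⟨i, -, rfl⟩ := Finset.mem_image.1 hu
    obtain ⟨j, -, rfl⟩ := Finset.mem_image.1 hw
    exact hcross i j fun h => huw (by rw [h])
  · intro u hu
    obtain ⟨i, -, rfl⟩ := Finset.mem_image.1 hu
    rw [← hval, hfac, Finset.prod_eq_zero (Finset.mem_univ i) (by simp only [v]; ring), mul_zero]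

lemma Rsr_eq_of_mem_distinctRealRoots {d : ℕ} (hd : Odd d) {f : Fin (d + 1) → ℝ}
    (hf : f ∈ distinctRealRoots d) : Rsr d f = d := by
  have hmem := exists_eq_sum_powVec hd hf
  refine le_antisymm (Nat.sInf_le hmem) (le_csInf ⟨d, hmem⟩ ?_)
  rintro r ⟨b, M, h⟩
  exact le_of_eq_sum_powVec hf h

/-- For odd `d = 2m+1 ≥ 5`, the integer `d` itself is a typical rank for real
bivariate degree-`d` forms; moreover it is attained on the open set of forms
with `d` distinct real roots (i.e. forms that split as a nonzero constant times
a product of `d` pairwise non-proportional real linear forms). -/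
theorem typical_rank_d_distinct_real_roots (m : ℕ) (hm : 5 ≤ 2 * m + 1) :
    IsTypicalRank (2 * m + 1) (2 * m + 1) ∧
    IsOpen {f : Fin (2 * m + 1 + 1) → ℝ |
        ∃ (c : ℝ) (L : Fin (2 * m + 1) → ℝ × ℝ), c ≠ 0 ∧ (∀ i, L i ≠ 0) ∧
          (∀ i j, i ≠ j → ¬ AreProportional (L i) (L j)) ∧
          ∀ x y : ℝ, evalVec (2 * m + 1) f x y = c * ∏ i, ((L i).1 * x + (L i).2 * y)} ∧
    Set.Nonempty {f : Fin (2 * m + 1 + 1) → ℝ |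
        ∃ (c : ℝ) (L : Fin (2 * m + 1) → ℝ × ℝ), c ≠ 0 ∧ (∀ i, L i ≠ 0) ∧
          (∀ i j, i ≠ j → ¬ AreProportional (L i) (L j)) ∧
          ∀ x y : ℝ, evalVec (2 * m + 1) f x y = c * ∏ i, ((L i).1 * x + (L i).2 * y)} ∧
    ∀ f ∈ {f : Fin (2 * m + 1 + 1) → ℝ |
        ∃ (c : ℝ) (L : Fin (2 * m + 1) → ℝ × ℝ), c ≠ 0 ∧ (∀ i, L i ≠ 0) ∧
          (∀ i j, i ≠ j → ¬ AreProportional (L i) (L j)) ∧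
          ∀ x y : ℝ, evalVec (2 * m + 1) f x y = c * ∏ i, ((L i).1 * x + (L i).2 * y)},
      Rsr (2 * m + 1) f = 2 * m + 1 := by
  have hopen := isOpen_distinctRealRoots (d := 2 * m + 1) (by omega)
  have hne := distinctRealRoots_nonempty (2 * m + 1)
  have hrank : ∀ f ∈ distinctRealRoots (2 * m + 1), Rsr (2 * m + 1) f = 2 * m + 1 :=
    fun f hf => Rsr_eq_of_mem_distinctRealRoots (odd_two_mul_add_one m) hf
  exact ⟨⟨_, hopen, hne, hrank⟩, hopen, hne, hrank⟩
end

section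
/- Let d ≥ 1 and let g ∈ ℂ[x,y]_d be nonzero. Suppose g = Σ_{i=1}^a a_i L_i^d with a_i ∈ ℂ and pairwise non-proportional linear forms L_i ∈ ℂ[x,y]_1, such that g is not a linear combination of the d-th powers of any proper subfamily of the L_i; and suppose likewise g = Σ_{j=1}^b b_j M_j^d with pairwise non-proportional M_j ∈ ℂ[x,y]_1 and g not a linear combination of the d-th powers of any proper subfamily of the M_j. Then either the two sets of points {[L_1], …, [L_a]} and {[M_1], …, [M_b]} in ℙ^1(ℂ) coincide, or the set {[L_1], …, [L_a]} ∪ {[M_1], …, [M_b]} has cardinality at least d + 2. -/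
theorem powVec_smul {K : Type*} [CommRing K] (d : ℕ) (t : K) (L : K × K) :
    powVec d (t • L) = t ^ d • powVec d L := by
  ext i
  have h : t ^ d = t ^ (i : ℕ) * t ^ (d - (i : ℕ)) := by
    rw [← pow_add, Nat.add_sub_cancel' (Nat.le_of_lt_succ i.2)]
  simp only [powVec, Prod.smul_fst, Prod.smul_snd, Pi.smul_apply, smul_eq_mul, mul_pow, h]
  ring

theorem linearIndependent_powVec {K : Type*} [Field K] [CharZero K] (d : ℕ)
    (v : Fin (d + 1) → K × K)
    (hv : ∀ i j, i ≠ j → (v j).1 * (v i).2 - (v i).1 * (v j).2 ≠ 0) :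
    LinearIndependent K fun i => powVec d (v i) := by
  let A : Matrix (Fin (d + 1)) (Fin (d + 1)) K :=
    Matrix.projVandermonde (fun i => (v i).1) (fun i => (v i).2) *
      Matrix.diagonal fun j : Fin (d + 1) => (d.choose j : K)
  have hA : A.det ≠ 0 := by
    rw [Matrix.det_mul, Matrix.det_projVandermonde, Matrix.det_diagonal]
    refine mul_ne_zero (Finset.prod_ne_zero_iff.2 fun i _ => Finset.prod_ne_zero_iff.2
      fun j hj => hv i j (Finset.mem_Ioi.1 hj).ne) (Finset.prod_ne_zero_iff.2 fun j _ => ?_)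
    exact_mod_cast (Nat.choose_pos (Nat.le_of_lt_succ j.2)).ne'
  convert! Matrix.linearIndependent_rows_of_det_ne_zero hA using 1
  ext i j
  simp only [A, Matrix.mul_diagonal, Matrix.projVandermonde_apply, powVec,
    Fin.val_rev, Nat.add_sub_add_right]
  ring

instance projectivization_prod_infinite {K : Type*} [Field K] [Infinite K] :
    Infinite (Projectivization K (K × K)) := by
  refine Infinite.of_injective
    (fun t : K => Projectivization.mk K (t, (1 : K)) (by simp)) fun s t h => ?_
  obtain ⟨u, hu⟩ := (Projectivization.mk_eq_mk_iff' K _ _ _ _).1 h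
  simp only [Prod.smul_mk, smul_eq_mul, mul_one, Prod.mk.injEq] at hu
  rw [← hu.1, hu.2, one_mul]

theorem Projectivization.rep_cross_ne_zero {K : Type*} [Field K]
    {p q : Projectivization K (K × K)} (h : p ≠ q) :
    q.rep.1 * p.rep.2 - p.rep.1 * q.rep.2 ≠ 0 := by
  intro h0
  have hli := Projectivization.linearIndependent_pair_iff_ne.2 h
  rw [LinearIndependent.pair_iff] at hli
  have h1 := hli q.rep.1 (-p.rep.1) (by
    ext
    · simp only [Prod.fst_add, Prod.smul_fst, Prod.fst_zero, smul_eq_mul]; ring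
    · simp only [Prod.snd_add, Prod.smul_snd, Prod.snd_zero, smul_eq_mul]; linear_combination h0)
  have h2 := hli q.rep.2 (-p.rep.2) (by
    ext
    · simp only [Prod.fst_add, Prod.smul_fst, Prod.fst_zero, smul_eq_mul]
      linear_combination -h0
    · simp only [Prod.snd_add, Prod.smul_snd, Prod.snd_zero, smul_eq_mul]; ring)
  exact q.rep_nonzero (Prod.ext h1.1 h2.1)

theorem linearIndepOn_powVec_rep {K : Type*} [Field K] [CharZero K] (d : ℕ)
    (T : Finset (Projectivization K (K × K))) (hT : T.card ≤ d + 1) :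
    LinearIndepOn K (fun p : Projectivization K (K × K) => powVec d p.rep) (T : Set _) := by
  obtain ⟨S, hTS, hS⟩ := Infinite.exists_superset_card_eq T (d + 1) hT
  refine LinearIndepOn.mono ?_ (Finset.coe_subset.2 hTS)
  let e := (S.equivFinOfCardEq hS).symm
  refine (linearIndependent_equiv e).1
    (linearIndependent_powVec d (fun i => (e i).1.rep) fun i j hij => ?_)
  exact Projectivization.rep_cross_ne_zero fun h => hij (e.injective (Subtype.ext h))

/-- An irredundant decomposition is a linear combination of `d`-th powers of the chosen
representatives, whose support is exactly the set of points of the decomposition. -/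
theorem exists_finsupp_of_irredundant {K : Type*} [Field K] (d a : ℕ) (g : Fin (d + 1) → K)
    (c : Fin a → K) (L : Fin a → K × K) (hL0 : ∀ i, L i ≠ 0)
    (hLp : ∀ i j, i ≠ j → ¬ AreProportional (L i) (L j))
    (hgL : g = ∑ i, c i • powVec d (L i))
    (hLmin : ∀ S : Finset (Fin a), S ≠ Finset.univ →
      ∀ c : Fin a → K, g ≠ ∑ i ∈ S, c i • powVec d (L i)) :
    ∃ f : Projectivization K (K × K) →₀ K,
      Finsupp.linearCombination K (fun p => powVec d p.rep) f = g ∧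
      (f.support : Set (Projectivization K (K × K))) =
        Set.range fun i => Projectivization.mk K (L i) (hL0 i) := by
  classical
  let P : Fin a → Projectivization K (K × K) := fun i => Projectivization.mk K (L i) (hL0 i)
  have hP : Function.Injective P := by
    intro i j hij
    by_contra hne
    obtain ⟨t, ht⟩ := (Projectivization.mk_eq_mk_iff' K _ _ _ _).1 hij
    exact hLp i j hne ⟨t, Or.inr ht.symm⟩
  have hc : ∀ i, c i ≠ 0 := by
    intro i hi
    refine hLmin (Finset.univ.erase i) (by simp [Finset.erase_eq_self]) c ?_
    rw [hgL, ← Finset.add_sum_erase _ _ (Finset.mem_univ i), hi, zero_smul, zero_add]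
  choose u hu using fun i => Projectivization.exists_smul_eq_mk_rep K (L i) (hL0 i)
  let f₀ : Fin a →₀ K := Finsupp.equivFunOnFinite.symm fun i => c i * ((u i : K) ^ d)⁻¹
  refine ⟨f₀.mapDomain P, ?_, ?_⟩
  · rw [Finsupp.linearCombination_mapDomain,
      Finsupp.linearCombination_apply, Finsupp.sum_fintype _ _ (by simp), hgL]
    refine Finset.sum_congr rfl fun i _ => ?_
    have : powVec d (P i).rep = (u i : K) ^ d • powVec d (L i) := by
      rw [← powVec_smul, ← Units.smul_def, hu]
    simp [f₀, this, smul_smul]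
  · rw [Finsupp.mapDomain_support_of_injective hP]
    have : f₀.support = Finset.univ := by
      ext i
      simp [f₀, hc i]
    simp [this, P]

/-- If a nonzero complex binary form `g` of degree `d` has two irredundant
decompositions as linear combinations of `d`-th powers of pairwise
non-proportional linear forms `L_i` (resp. `M_j`), then either the two sets of
associated points in `ℙ¹(ℂ)` coincide, or their union has at least `d + 2`
points. -/
theorem two_decompositions_eq_or_large_union (d : ℕ) (hd : 1 ≤ d) (a b : ℕ)
    (g : Fin (d + 1) → ℂ) (hg : g ≠ 0)
    (ca : Fin a → ℂ) (L : Fin a → ℂ × ℂ) (hL0 : ∀ i, L i ≠ 0)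
    (hLp : ∀ i j, i ≠ j → ¬ AreProportional (L i) (L j))
    (hgL : g = ∑ i, ca i • powVec d (L i))
    (hLmin : ∀ S : Finset (Fin a), S ≠ Finset.univ →
      ∀ c : Fin a → ℂ, g ≠ ∑ i ∈ S, c i • powVec d (L i))
    (cb : Fin b → ℂ) (M : Fin b → ℂ × ℂ) (hM0 : ∀ j, M j ≠ 0)
    (hMp : ∀ i j, i ≠ j → ¬ AreProportional (M i) (M j))
    (hgM : g = ∑ j, cb j • powVec d (M j))
    (hMmin : ∀ S : Finset (Fin b), S ≠ Finset.univ →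
      ∀ c : Fin b → ℂ, g ≠ ∑ j ∈ S, c j • powVec d (M j)) :
    (Set.range fun i => Projectivization.mk ℂ (L i) (hL0 i)) =
        (Set.range fun j => Projectivization.mk ℂ (M j) (hM0 j)) ∨
      d + 2 ≤ ((Set.range fun i => Projectivization.mk ℂ (L i) (hL0 i)) ∪
        (Set.range fun j => Projectivization.mk ℂ (M j) (hM0 j))).ncard := by
  obtain ⟨f, hf, hfs⟩ := exists_finsupp_of_irredundant d a g ca L hL0 hLp hgL hLmin
  obtain ⟨f', hf', hfs'⟩ := exists_finsupp_of_irredundant d b g cb M hM0 hMp hgM hMmin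
  classical
  rw [← hfs, ← hfs', or_iff_not_imp_right, ← Finset.coe_union, Set.ncard_coe_finset, not_le]
  intro hlt
  have hli := linearIndepOn_powVec_rep (K := ℂ) d (f.support ∪ f'.support) (by omega)
  have hff' : f - f' = 0 := by
    refine linearIndepOn_iff.1 hli (f - f') ?_ (by rw [map_sub, hf, hf', sub_self])
    rw [Finsupp.mem_supported]
    exact Finset.coe_subset.2 Finsupp.support_sub
  rw [sub_eq_zero.1 hff']
end

section
/- Let d ≥ 1 and let g ∈ ℂ[x,y]_d be nonzero with complex rank Csr(g) = r, where 2r ≤ d + 1. If g = Σ_{i=1}^r a_i L_i^d and g = Σ_{i=1}^r b_i M_i^d are two decompositions with all coefficients a_i, b_i nonzero and with the L_i pairwise non-proportional and the M_i pairwise non-proportional, then the sets of points {[L_1], …, [L_r]} and {[M_1], …, [M_r]} in ℙ^1(ℂ) coincide; i.e., the minimal decomposition of g is unique up to proportionality of the linear forms. -/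
open Finset in
/-- A product of `d` linear functionals, evaluated at `v`, is a linear functional of the
coefficient vector of the `d`-th power of the linear form `v`. -/
theorem exists_linearMap_powVec_eq_prod {K ι : Type*} [Field K] [CharZero K] [Fintype ι]
    {d : ℕ} (hι : Fintype.card ι = d) (N : ι → K × K) :
    ∃ φ : (Fin (d + 1) → K) →ₗ[K] K,
      ∀ v : K × K, φ (powVec d v) = ∏ k, ((N k).1 * v.1 + (N k).2 * v.2) := by
  classical
  have hcard (t : Finset ι) : #t < d + 1 := by
    have := t.card_le_univ
    omega
  refine ⟨∑ t : Finset ι, (((d.choose #t : K)⁻¹ * ((∏ k ∈ t, (N k).1) * ∏ k ∈ tᶜ, (N k).2)) •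
    LinearMap.proj (⟨#t, hcard t⟩ : Fin (d + 1))), fun v => ?_⟩
  rw [Fintype.prod_add, LinearMap.sum_apply]
  refine Finset.sum_congr rfl fun t _ => ?_
  have hchoose : (d.choose #t : K) ≠ 0 :=
    Nat.cast_ne_zero.2 (Nat.choose_pos (Nat.lt_succ_iff.1 (hcard t))).ne'
  simp only [LinearMap.smul_apply, LinearMap.proj_apply, powVec, smul_eq_mul,
    Finset.prod_mul_distrib, Finset.prod_const, Finset.card_compl, hι]
  field_simp

theorem exists_eq_smul_of_det_eq_zero {K : Type*} [Field K] {u v : K × K} (hu : u ≠ 0)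
    (h : u.2 * v.1 - u.1 * v.2 = 0) : ∃ t : K, v = t • u := by
  by_cases h1 : u.1 = 0
  · have h2 : u.2 ≠ 0 := fun h2 => hu (Prod.ext h1 h2)
    refine ⟨v.2 / u.2, Prod.ext ?_ ?_⟩
    · simpa [h1, h2] using h
    · simp [h2]
  · refine ⟨v.1 / u.1, Prod.ext ?_ ?_⟩
    · simp [h1]
    · simp only [Prod.smul_snd, smul_eq_mul]
      field_simp
      linear_combination -h

/-- If a form of degree `d ≥ 2r - 1` has two decompositions with `r` terms, then every linear
form of the first one is proportional to some linear form of the second one. -/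
theorem exists_det_eq_zero_of_sum_powVec_eq {K : Type*} [Field K] [CharZero K] {d r : ℕ}
    (hr : 2 * r ≤ d + 1) {a b : Fin r → K} (ha : ∀ i, a i ≠ 0) {L M : Fin r → K × K}
    (hL0 : ∀ i, L i ≠ 0) (hLp : ∀ i j, i ≠ j → ¬ AreProportional (L i) (L j))
    (h : ∑ i, a i • powVec d (L i) = ∑ i, b i • powVec d (M i)) (i : Fin r) :
    ∃ j, (M j).2 * (L i).1 - (M j).1 * (L i).2 = 0 := by
  by_contra! hM
  let N : {j // j ≠ i} ⊕ (Fin r ⊕ Fin (d + 1 - 2 * r)) → K × K :=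
    Sum.elim (fun j => L j) (Sum.elim M fun _ => M i)
  have hcard : Fintype.card ({j // j ≠ i} ⊕ (Fin r ⊕ Fin (d + 1 - 2 * r))) = d := by
    have := i.pos
    simp only [Fintype.card_sum, Fintype.card_fin, ne_eq, Fintype.card_subtype_compl,
      Fintype.card_unique]
    omega
  obtain ⟨φ, hφ⟩ := exists_linearMap_powVec_eq_prod hcard fun k => ((N k).2, -(N k).1)
  have hφM (j : Fin r) : φ (powVec d (M j)) = 0 := by
    rw [hφ]
    exact Finset.prod_eq_zero (Finset.mem_univ (Sum.inr (Sum.inl j))) (by simp [N]; ring)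
  have hφL (j : Fin r) (hj : j ≠ i) : φ (powVec d (L j)) = 0 := by
    rw [hφ]
    exact Finset.prod_eq_zero (Finset.mem_univ (Sum.inl ⟨j, hj⟩)) (by simp [N]; ring)
  have hφi : φ (powVec d (L i)) ≠ 0 := by
    rw [hφ, Finset.prod_ne_zero_iff]
    rintro (⟨j, hj⟩ | j | j) - <;> simp only [N, Sum.elim_inl, Sum.elim_inr, neg_mul,
      ← sub_eq_add_neg]
    · intro h0
      obtain ⟨t, ht⟩ := exists_eq_smul_of_det_eq_zero (hL0 j) h0
      exact hLp j i hj ⟨t, Or.inl ht⟩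
    · exact hM j
    · exact hM i
  have key := congrArg φ h
  simp only [map_sum, map_smul, hφM, smul_zero, Finset.sum_const_zero] at key
  rw [Finset.sum_eq_single_of_mem i (Finset.mem_univ i)
    fun j _ hj => by rw [hφL j hj, smul_zero]] at key
  exact smul_ne_zero (ha i) hφi key

theorem range_mk_subset_of_sum_powVec_eq {K : Type*} [Field K] [CharZero K] {d r : ℕ}
    (hr : 2 * r ≤ d + 1) {a b : Fin r → K} (ha : ∀ i, a i ≠ 0) {L M : Fin r → K × K}
    (hL0 : ∀ i, L i ≠ 0) (hLp : ∀ i j, i ≠ j → ¬ AreProportional (L i) (L j))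
    (hM0 : ∀ i, M i ≠ 0)
    (h : ∑ i, a i • powVec d (L i) = ∑ i, b i • powVec d (M i)) :
    (Set.range fun i => Projectivization.mk K (L i) (hL0 i)) ⊆
      Set.range fun i => Projectivization.mk K (M i) (hM0 i) := by
  rintro _ ⟨i, rfl⟩
  obtain ⟨j, hj⟩ := exists_det_eq_zero_of_sum_powVec_eq hr ha hL0 hLp h i
  obtain ⟨t, ht⟩ := exists_eq_smul_of_det_eq_zero (hM0 j) hj
  exact ⟨j, ((Projectivization.mk_eq_mk_iff' K _ _ (hL0 i) (hM0 j)).2 ⟨t, ht.symm⟩).symm⟩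

/-- If a nonzero complex binary form `g` of degree `d` has complex rank `r` with
`2r ≤ d + 1`, then its minimal decomposition is unique: any two decompositions
with `r` terms, nonzero coefficients and pairwise non-proportional linear forms
determine the same set of points in `ℙ¹(ℂ)`. -/
theorem minimal_decomposition_unique (d r : ℕ) (hd : 1 ≤ d) (hr : 2 * r ≤ d + 1)
    (g : Fin (d + 1) → ℂ) (hg : g ≠ 0) (hrank : Csr d g = r)
    (ca : Fin r → ℂ) (hca : ∀ i, ca i ≠ 0)
    (L : Fin r → ℂ × ℂ) (hL0 : ∀ i, L i ≠ 0)
    (hLp : ∀ i j, i ≠ j → ¬ AreProportional (L i) (L j))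
    (hgL : g = ∑ i, ca i • powVec d (L i))
    (cb : Fin r → ℂ) (hcb : ∀ i, cb i ≠ 0)
    (M : Fin r → ℂ × ℂ) (hM0 : ∀ i, M i ≠ 0)
    (hMp : ∀ i j, i ≠ j → ¬ AreProportional (M i) (M j))
    (hgM : g = ∑ i, cb i • powVec d (M i)) :
    (Set.range fun i => Projectivization.mk ℂ (L i) (hL0 i)) =
      (Set.range fun i => Projectivization.mk ℂ (M i) (hM0 i)) := by
  have h := hgL.symm.trans hgM
  exact (range_mk_subset_of_sum_powVec_eq hr hca hL0 hLp hM0 h).antisymm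
    (range_mk_subset_of_sum_powVec_eq hr hcb hM0 hMp hL0 h.symm)
end

section
/- Let d = 2m + 1 ≥ 3 be odd. Let L_1, …, L_{m+1} ∈ ℝ[x,y]_1 be pairwise non-proportional real linear forms and let c_1, …, c_{m+1} be nonzero real numbers. Then the form f = Σ_{i=1}^{m+1} c_i L_i^d satisfies Csr(f) = m + 1 and Rsr(f) = m + 1. -/
/-- `F` is given by a homogeneous bivariate polynomial of degree `n`. -/
def IsBinaryForm {K : Type*} [CommRing K] (n : ℕ) (F : K × K → K) : Prop :=
  ∃ g : ℕ → K, ∀ v : K × K, F v = ∑ i ∈ Finset.range (n + 1), g i * v.1 ^ i * v.2 ^ (n - i)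

/-- The determinant pairing of two linear forms. -/
def detPair {K : Type*} [CommRing K] (u v : K × K) : K := u.1 * v.2 - u.2 * v.1

lemma IsBinaryForm.one {K : Type*} [CommRing K] : IsBinaryForm 0 (fun _ : K × K => 1) :=
  ⟨fun _ => 1, fun v => by simp⟩

lemma IsBinaryForm.detPair_mul {K : Type*} [CommRing K] {n : ℕ} {F : K × K → K}
    (hF : IsBinaryForm n F) (u : K × K) :
    IsBinaryForm (n + 1) (fun v => detPair u v * F v) := by
  obtain ⟨g, hg⟩ := hF
  refine ⟨fun i => u.1 * (if i ≤ n then g i else 0) -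
    u.2 * (if i = 0 then 0 else g (i - 1)), fun v => ?_⟩
  simp only [sub_mul, Finset.sum_sub_distrib, detPair]
  congr 1
  · rw [Finset.sum_range_succ, hg, Finset.mul_sum]
    simp only [Nat.succ_le_iff, lt_irrefl, if_false, mul_zero, zero_mul, add_zero]
    refine Finset.sum_congr rfl fun i hi => ?_
    have hi : i ≤ n := Nat.lt_succ_iff.mp (Finset.mem_range.mp hi)
    rw [if_pos hi, Nat.sub_add_comm hi]
    ring
  · rw [Finset.sum_range_succ', hg, Finset.mul_sum]
    simp only [if_true, mul_zero, zero_mul, add_zero]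
    refine Finset.sum_congr rfl fun i hi => ?_
    simp only [Nat.add_eq_zero_iff, one_ne_zero, and_false, if_false, Nat.add_sub_cancel,
      Nat.add_sub_add_right]
    ring

lemma IsBinaryForm.prod_detPair_mul {K ι : Type*} [CommRing K] {n : ℕ} {F : K × K → K}
    (hF : IsBinaryForm n F) (s : Finset ι) (u : ι → K × K) :
    IsBinaryForm (n + s.card) (fun v => (∏ i ∈ s, detPair (u i) v) * F v) := by
  classical
  induction s using Finset.induction_on with
  | empty => simpa using hF
  | insert a s ha ih =>
    simp only [Finset.prod_insert ha, Finset.card_insert_of_notMem ha, mul_assoc]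
    exact ih.detPair_mul (u a)

/-- Every form of degree `d` is the evaluation of a linear functional on `d`-th powers. -/
lemma IsBinaryForm.exists_functional {K : Type*} [Field K] [CharZero K] {d : ℕ}
    {F : K × K → K} (hF : IsBinaryForm d F) :
    ∃ φ : (Fin (d + 1) → K) →ₗ[K] K, ∀ v, φ (powVec d v) = F v := by
  obtain ⟨g, hg⟩ := hF
  refine ⟨∑ i : Fin (d + 1), (g i / (d.choose i : K)) • LinearMap.proj i, fun v => ?_⟩
  rw [hg, Finset.sum_range]
  simp only [LinearMap.sum_apply, LinearMap.smul_apply, LinearMap.proj_apply, smul_eq_mul, powVec]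
  refine Finset.sum_congr rfl fun i _ => ?_
  have : (d.choose (i : ℕ) : K) ≠ 0 :=
    Nat.cast_ne_zero.mpr (Nat.choose_pos (Nat.lt_succ_iff.mp i.2)).ne'
  field_simp

lemma exists_detPair_ne_zero {K : Type*} [Field K] {v : K × K} (hv : v ≠ 0) :
    ∃ u, detPair u v ≠ 0 := by
  by_contra! h
  apply hv
  have h1 := h (1, 0)
  have h2 := h (0, 1)
  simp only [detPair] at h1 h2
  ext <;> simp_all

lemma detPair_self {K : Type*} [CommRing K] (v : K × K) : detPair v v = 0 := by
  simp only [detPair]; ring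

lemma detPair_zero_right {K : Type*} [CommRing K] (u : K × K) : detPair u 0 = 0 := by
  simp [detPair]

lemma detPair_eq_zero_of_common {K : Type*} [Field K] {w u v : K × K} (hw : w ≠ 0)
    (hu : detPair w u = 0) (hv : detPair w v = 0) : detPair u v = 0 := by
  simp only [detPair] at *
  by_cases h1 : w.1 = 0
  · have h2 : w.2 ≠ 0 := fun h2 => hw (Prod.ext h1 h2)
    apply mul_left_cancel₀ h2
    linear_combination u.2 * hv - v.2 * hu
  · apply mul_left_cancel₀ h1
    linear_combination u.1 * hv - v.1 * hu

lemma areProportional_of_detPair_eq_zero {K : Type*} [Field K] {u v : K × K}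
    (h : detPair u v = 0) : AreProportional u v := by
  simp only [detPair] at h
  by_cases h1 : u.1 = 0
  · by_cases h2 : u.2 = 0
    · exact ⟨0, Or.inr (by rw [zero_smul]; exact Prod.ext h1 h2)⟩
    · refine ⟨v.2 / u.2, Or.inl (Prod.ext ?_ ?_)⟩ <;> simp only [Prod.smul_fst, Prod.smul_snd,
        smul_eq_mul] <;> field_simp
      linear_combination -h
  · refine ⟨v.1 / u.1, Or.inl (Prod.ext ?_ ?_)⟩ <;> simp only [Prod.smul_fst, Prod.smul_snd,
      smul_eq_mul] <;> field_simp
    linear_combination h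

/-- A combination of `n` pairwise independent `d`-th powers with nonzero coefficients is not
a combination of `r < n` powers, as long as `r + n ≤ d + 1`. -/
lemma sum_powVec_ne_of_lt {K : Type*} [Field K] [CharZero K] {d n r : ℕ} (hr : r < n)
    (hd : r + n ≤ d + 1) {L : Fin n → K × K} (hL0 : ∀ i, L i ≠ 0)
    (hL : ∀ i j, i ≠ j → detPair (L i) (L j) ≠ 0) {c : Fin n → K} (hc : ∀ i, c i ≠ 0)
    (b : Fin r → K) (M : Fin r → K × K) :
    ∑ i, c i • powVec d (L i) ≠ ∑ j, b j • powVec d (M j) := by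
  intro heq
  obtain ⟨k, hk⟩ : ∃ k, ∀ j, M j ≠ 0 → detPair (M j) (L k) ≠ 0 := by
    by_contra! h
    choose φ hφ0 hφ using h
    have hinj : Function.Injective φ := fun x y hxy => by
      by_contra hne
      exact hL x y hne (detPair_eq_zero_of_common (hφ0 x) (hφ x) (hxy ▸ hφ y))
    have := Fintype.card_le_of_injective φ hinj
    simp only [Fintype.card_fin] at this
    omega
  obtain ⟨u, hu⟩ := exists_detPair_ne_zero (hL0 k)
  have hN : ∀ j, ∃ N, detPair N (M j) = 0 ∧ detPair N (L k) ≠ 0 := fun j => by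
    by_cases hj : M j = 0
    · exact ⟨u, by rw [hj, detPair_zero_right], hu⟩
    · exact ⟨M j, detPair_self _, hk j hj⟩
  choose N hNM hNL using hN
  have hform := ((IsBinaryForm.one (K := K).prod_detPair_mul Finset.univ N).prod_detPair_mul
    (Finset.univ.erase k) L).prod_detPair_mul (Finset.range (d + 1 - r - n)) (fun _ => u)
  have hdeg : 0 + (Finset.univ : Finset (Fin r)).card + (Finset.univ.erase k).card +
      (Finset.range (d + 1 - r - n)).card = d := by
    rw [Finset.card_erase_of_mem (Finset.mem_univ k)]
    simp only [Finset.card_univ, Fintype.card_fin, Finset.card_range]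
    omega
  rw [hdeg] at hform
  obtain ⟨φ, hφ⟩ := hform.exists_functional
  have key := congrArg φ heq
  simp only [map_sum, map_smul, hφ, smul_eq_mul, mul_one] at key
  rw [Finset.sum_eq_single k, Finset.sum_eq_zero] at key
  · refine mul_ne_zero (hc k) (mul_ne_zero ?_ (mul_ne_zero ?_ ?_)) key
    · exact Finset.prod_ne_zero_iff.mpr fun _ _ => hu
    · exact Finset.prod_ne_zero_iff.mpr fun i hi => hL i k (Finset.ne_of_mem_erase hi)
    · exact Finset.prod_ne_zero_iff.mpr fun j _ => hNL j
  · intro j _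
    rw [Finset.prod_eq_zero (Finset.mem_univ j) (hNM j)]
    simp
  · intro i _ hi
    rw [Finset.prod_eq_zero (Finset.mem_erase.mpr ⟨hi, Finset.mem_univ i⟩) (detPair_self (L i))]
    simp
  · simp

lemma rankK_sum_powVec {K : Type*} [Field K] [CharZero K] {d n : ℕ} (hd : 2 * n ≤ d + 2)
    {L : Fin n → K × K} (hL0 : ∀ i, L i ≠ 0)
    (hL : ∀ i j, i ≠ j → detPair (L i) (L j) ≠ 0) {c : Fin n → K} (hc : ∀ i, c i ≠ 0) :
    rankK K d (∑ i, c i • powVec d (L i)) = n := by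
  refine le_antisymm (Nat.sInf_le ⟨c, L, rfl⟩) (le_csInf ⟨n, c, L, rfl⟩ ?_)
  rintro r ⟨b, M, h⟩
  by_contra! hr
  exact sum_powVec_ne_of_lt hr (by omega) hL0 hL hc b M h

lemma complexify_sum_powVec {d n : ℕ} (c : Fin n → ℝ) (L : Fin n → ℝ × ℝ) :
    complexify (∑ i, c i • powVec d (L i)) =
      ∑ i, (c i : ℂ) • powVec d (((L i).1 : ℂ), ((L i).2 : ℂ)) := by
  ext k
  simp [complexify, powVec, Finset.sum_apply]

/-- For odd `d = 2m+1 ≥ 3`, a real form `f = ∑_{i=1}^{m+1} c_i L_i^d` with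
nonzero real coefficients and pairwise non-proportional real linear forms
satisfies `Csr f = m + 1` and `Rsr f = m + 1`. -/
theorem rank_of_general_real_decomposition (m : ℕ) (hm : 3 ≤ 2 * m + 1)
    (L : Fin (m + 1) → ℝ × ℝ) (hL0 : ∀ i, L i ≠ 0)
    (hLp : ∀ i j, i ≠ j → ¬ AreProportional (L i) (L j))
    (c : Fin (m + 1) → ℝ) (hc : ∀ i, c i ≠ 0) :
    Csr (2 * m + 1) (complexify (∑ i, c i • powVec (2 * m + 1) (L i))) = m + 1 ∧
      Rsr (2 * m + 1) (∑ i, c i • powVec (2 * m + 1) (L i)) = m + 1 := by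
  have hdet : ∀ i j, i ≠ j → detPair (L i) (L j) ≠ 0 := fun i j hij h =>
    hLp i j hij (areProportional_of_detPair_eq_zero h)
  refine ⟨?_, rankK_sum_powVec (by omega) hL0 hdet hc⟩
  rw [complexify_sum_powVec]
  refine rankK_sum_powVec (by omega) (fun i h => hL0 i ?_) (fun i j hij h => hdet i j hij ?_)
    (fun i => Complex.ofReal_ne_zero.mpr (hc i))
  · simpa [Prod.ext_iff] using h
  · simp only [detPair] at h ⊢
    exact_mod_cast h
end

section
/- Let d ≥ 1. If t is a typical rank for real bivariate homogeneous forms of degree d, then t ≥ ⌊(d+2)/2⌋. -/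
/-- Every binary form over a field of characteristic zero is a combination of powers of
linear forms. -/
theorem exists_eq_sum_smul_powVec {K : Type*} [Field K] [CharZero K] (d : ℕ)
    (f : Fin (d + 1) → K) :
    ∃ (c : Fin (d + 1) → K) (L : Fin (d + 1) → K × K), f = ∑ i, c i • powVec d (L i) := by
  let x : Fin (d + 1) → K := fun i => ((i : ℕ) : K)
  have hx : Function.Injective x := fun i j h => Fin.ext (Nat.cast_injective h)
  have hV : IsUnit (Matrix.vandermonde x) :=
    (Matrix.isUnit_iff_isUnit_det _).2 (Matrix.det_vandermonde_ne_zero_iff.2 hx).isUnit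
  obtain ⟨c, hc⟩ := Matrix.vecMul_surjective_iff_isUnit.2 hV
    (fun k : Fin (d + 1) => f k / (d.choose (k : ℕ) : K))
  refine ⟨c, fun i => (x i, 1), funext fun k => ?_⟩
  have hk : (d.choose (k : ℕ) : K) ≠ 0 :=
    Nat.cast_ne_zero.2 (Nat.choose_pos (Nat.lt_succ_iff.1 k.isLt)).ne'
  have h := congrFun hc k
  simp only [Matrix.vecMul, dotProduct, Matrix.vandermonde_apply] at h
  rw [eq_div_iff hk, Finset.sum_mul] at h
  rw [← h, Finset.sum_apply]
  refine Finset.sum_congr rfl fun i _ => ?_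
  simp only [powVec, Pi.smul_apply, smul_eq_mul, one_pow]
  ring

/-- The minimum in the definition of the rank is attained. -/
theorem exists_eq_sum_rankK {K : Type*} [Field K] [CharZero K] (d : ℕ) (f : Fin (d + 1) → K) :
    ∃ (c : Fin (rankK K d f) → K) (L : Fin (rankK K d f) → K × K),
      f = ∑ i, c i • powVec d (L i) :=
  Nat.sInf_mem (s := {r : ℕ | ∃ (c : Fin r → K) (L : Fin r → K × K),
    f = ∑ i, c i • powVec d (L i)}) ⟨d + 1, exists_eq_sum_smul_powVec d f⟩

/-- The square catalecticant (Hankel) matrix of size `t + 1` of a form of degree `d ≥ 2 * t`. -/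
def catalecticant {K : Type*} [Field K] {d t : ℕ} (h : 2 * t ≤ d) (f : Fin (d + 1) → K) :
    Matrix (Fin (t + 1)) (Fin (t + 1)) K :=
  Matrix.of fun a b => f ⟨a + b, by omega⟩ / (d.choose (a + b : ℕ) : K)

theorem catalecticant_add_smul {K : Type*} [Field K] {d t : ℕ} (h : 2 * t ≤ d)
    (f g : Fin (d + 1) → K) (s : K) :
    catalecticant h (f + s • g) = catalecticant h f + s • catalecticant h g := by
  ext a b
  simp [catalecticant, add_div, mul_div_assoc]

/-- The catalecticant of a sum of `t` powers factors through a `t`-dimensional space. -/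
theorem det_catalecticant_sum_smul_powVec {K : Type*} [Field K] [CharZero K] {d t : ℕ}
    (h : 2 * t ≤ d) (c : Fin t → K) (L : Fin t → K × K) :
    (catalecticant h (∑ i, c i • powVec d (L i))).det = 0 := by
  let A : Matrix (Fin (t + 1)) (Fin t) K :=
    Matrix.of fun a i => c i * (L i).1 ^ (a : ℕ) * (L i).2 ^ (t - (a : ℕ))
  let B : Matrix (Fin t) (Fin (t + 1)) K :=
    Matrix.of fun i b => (L i).1 ^ (b : ℕ) * (L i).2 ^ (d - t - (b : ℕ))
  have hAB : catalecticant h (∑ i, c i • powVec d (L i)) = A * B := by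
    ext a b
    have hk : (d.choose (a + b : ℕ) : K) ≠ 0 :=
      Nat.cast_ne_zero.2 (Nat.choose_pos (by omega)).ne'
    have he : d - (a + b : ℕ) = (t - a) + (d - t - b) := by omega
    simp only [catalecticant, Matrix.of_apply, Matrix.mul_apply, A, B, Finset.sum_apply]
    rw [div_eq_iff hk, Finset.sum_mul]
    refine Finset.sum_congr rfl fun i _ => ?_
    simp only [powVec, Pi.smul_apply, smul_eq_mul, he]
    ring
  by_contra hdet
  have hrank := Matrix.rank_of_isUnit _ ((Matrix.isUnit_iff_isUnit_det _).2 (isUnit_iff_ne_zero.2 hdet))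
  have hle : (A * B).rank ≤ t :=
    (Matrix.rank_mul_le_left A B).trans (by simpa using Matrix.rank_le_width A)
  rw [hAB, Fintype.card_fin] at hrank
  omega

/-- Some form of degree `d ≥ 2 * t` has an invertible catalecticant of size `t + 1`. -/
theorem exists_det_catalecticant_ne_zero {K : Type*} [Field K] [CharZero K] {d t : ℕ}
    (h : 2 * t ≤ d) : ∃ g : Fin (d + 1) → K, (catalecticant h g).det ≠ 0 := by
  refine ⟨fun k => if (k : ℕ) = t then (d.choose t : K) else 0, ?_⟩
  have hk : (d.choose t : K) ≠ 0 := Nat.cast_ne_zero.2 (Nat.choose_pos (by omega)).ne'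
  set M := catalecticant h (fun k => if (k : ℕ) = t then (d.choose t : K) else 0) with hM
  have hrev : M.submatrix Fin.revPerm id = 1 := by
    ext a b
    have hiff : ((Fin.rev a : Fin (t + 1)) : ℕ) + b = t ↔ a = b := by
      rw [Fin.val_rev, Fin.ext_iff]
      omega
    simp only [hM, catalecticant, Matrix.submatrix_apply, Matrix.of_apply, Fin.revPerm_apply,
      id_eq, Matrix.one_apply, hiff]
    split_ifs with hab
    · rw [hiff.2 hab, div_self hk]
    · exact zero_div _
  intro hdet
  have hperm := Matrix.det_permute Fin.revPerm M
  rw [hrev, hdet, Matrix.det_one, mul_zero] at hperm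
  exact one_ne_zero hperm

/-- A nonempty open set of forms contains a form with invertible catalecticant. -/
theorem exists_mem_det_catalecticant_ne_zero {d t : ℕ} (h : 2 * t ≤ d)
    {V : Set (Fin (d + 1) → ℝ)} (hV : IsOpen V) (hne : V.Nonempty) :
    ∃ f ∈ V, (catalecticant h f).det ≠ 0 := by
  obtain ⟨f, hf⟩ := hne
  obtain ⟨g, hg⟩ := exists_det_catalecticant_ne_zero (K := ℝ) h
  by_contra! hzero
  let p : Polynomial ℝ := Matrix.det ((Polynomial.X : Polynomial ℝ) •
    (catalecticant h g).map Polynomial.C + (catalecticant h f).map Polynomial.C)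
  have hp : p ≠ 0 := fun h0 => hg <| by
    rw [← Polynomial.coeff_det_X_add_C_card (catalecticant h g) (catalecticant h f)]
    exact (congrArg (fun q : Polynomial ℝ => q.coeff _) h0).trans (Polynomial.coeff_zero _)
  have hline : Continuous fun s : ℝ => f + s • g := by fun_prop
  have hnhds : (fun s : ℝ => f + s • g) ⁻¹' V ∈ nhds (0 : ℝ) :=
    (hV.preimage hline).mem_nhds (by simpa using hf)
  refine hp (Polynomial.eq_zero_of_infinite_isRoot p
    ((infinite_of_mem_nhds 0 hnhds).mono fun s hs => ?_))
  have hs0 := hzero _ hs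
  rw [catalecticant_add_smul] at hs0
  change p.eval s = 0
  rw [← hs0, ← Polynomial.coe_evalRingHom, RingHom.map_det]
  congr 1
  ext a b
  simp [add_comm, mul_comm s]

/-- Every typical rank for real binary forms of degree `d ≥ 1` is at least
`⌊(d+2)/2⌋`. -/
theorem typical_rank_lower_bound (d t : ℕ) (hd : 1 ≤ d)
    (ht : IsTypicalRank d t) : (d + 2) / 2 ≤ t := by
  obtain ⟨V, hV, hne, hrank⟩ := ht
  by_contra hlt
  have h : 2 * t ≤ d := by omega
  obtain ⟨f, hf, hdet⟩ := exists_mem_det_catalecticant_ne_zero h hV hne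
  have hdec := exists_eq_sum_rankK d f
  rw [show rankK ℝ d f = t from hrank f hf] at hdec
  obtain ⟨c, L, rfl⟩ := hdec
  exact hdet (det_catalecticant_sum_smul_powVec h c L)
end
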